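/- Let Ω be any triangle with sides S, M, L ordered nondecreasingly by length. Then λ₁^L ≤ λ₁^{M∪S}, i.e., the lowest eigenvalue of the Laplacian on Ω with Dirichlet condition on the longest side L and Neumann condition on the other two sides is at most the lowest eigenvalue with Dirichlet condition on M ∪ S and Neumann condition on L. -/

import Mathlib

open MeasureTheory EuclideanGeometry Real

noncomputable section

/-- Points of the plane. -/
abbrev Pt := EuclideanSpace ℝ (Fin 2)

/-- `i`-th partial derivative of `u`. -/
def pd (i : Fin 2) (u : Pt → ℝ) (x : Pt) : ℝ := fderiv ℝ u x (EuclideanSpace.single i 1)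

/-- Second partial derivative `∂ᵢ∂ⱼ u`. -/
def pdd (i j : Fin 2) (u : Pt → ℝ) : Pt → ℝ := pd i (pd j u)

/-- A (closed, nondegenerate) line segment in the plane. -/
def IsSegSet (s : Set Pt) : Prop := ∃ a b : Pt, a ≠ b ∧ s = segment ℝ a b

/-- `Ω` is an open bounded convex polygon whose boundary is the union of the finitely
many sides in `Sides`. -/
def IsConvexPolygon (Ω : Set Pt) (Sides : Finset (Set Pt)) : Prop :=
  IsOpen Ω ∧ Convex ℝ Ω ∧ Bornology.IsBounded Ω ∧ Ω.Nonempty ∧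
    (∀ s ∈ Sides, IsSegSet s) ∧ frontier Ω = ⋃ s ∈ Sides, s

/-- `Γ` is the union of the sides in the subcollection `T` of `Sides`. -/
def UnionOfSides (Γ : Set Pt) (Sides T : Finset (Set Pt)) : Prop :=
  T ⊆ Sides ∧ Γ = ⋃ s ∈ T, s

/-- `n` is the outward unit normal of `Ω` along the side `s`. -/
def IsOuterNormal (Ω s : Set Pt) (n : Pt) : Prop :=
  ‖n‖ = 1 ∧ ∀ x ∈ s, ∀ y ∈ Ω, n 0 * (y 0 - x 0) + n 1 * (y 1 - x 1) ≤ 0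

/-- `u` satisfies a (pointwise) Neumann boundary condition on the side `s` of `Ω`. -/
def NeumannOn (Ω s : Set Pt) (u : Pt → ℝ) : Prop :=
  ∃ n : Pt, IsOuterNormal Ω s n ∧ ∀ x ∈ s, pd 0 u x * n 0 + pd 1 u x * n 1 = 0

/-- (Regular representative of) membership in `H²(Ω)`. -/
def MemH2 (Ω : Set Pt) (u : Pt → ℝ) : Prop := ContDiffOn ℝ 2 u (closure Ω)

/-- (Regular representative of) membership in `H¹(Ω)`. -/
def MemH1 (Ω : Set Pt) (u : Pt → ℝ) : Prop := ContDiffOn ℝ 1 u (closure Ω)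

/-- The set of Rayleigh quotients of admissible test functions vanishing on `Sig`. -/
def RayleighSet (Ω Sig : Set Pt) : Set ℝ :=
  { r | ∃ u : Pt → ℝ, MemH1 Ω u ∧ (∀ x ∈ Sig, u x = 0) ∧ (∫ x in Ω, (u x) ^ 2) ≠ 0 ∧
      r = (∫ x in Ω, ((pd 0 u x) ^ 2 + (pd 1 u x) ^ 2)) / (∫ x in Ω, (u x) ^ 2) }

/-- The lowest eigenvalue `λ₁^Σ` of the mixed Dirichlet(Σ)–Neumann Laplacian on `Ω`,
as the infimum of the Rayleigh quotient. -/
def lambda1 (Ω Sig : Set Pt) : ℝ := sInf (RayleighSet Ω Sig)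

open Filter Topology

def dv (x : ℕ → ℝ) : ℕ → ℝ
  | 0 => 0
  | j+1 => x (j+1) - x j

def phi (n : ℕ) (x : ℕ → ℝ) (j : ℕ) : ℝ := if j < n then dv x j - dv x (j+1) else 0

def cw (i : ℕ) : ℝ := if i = 0 then 1/2 else 1

lemma col_M (n : ℕ) (x : ℕ → ℝ) (hx : x n = 0) :
    ∑ j ∈ Finset.range n, x j * phi n x j = ∑ j ∈ Finset.range n, (dv x (j+1))^2 := by
  have h1 : ∑ j ∈ Finset.range n, x j * phi n x j
      = ∑ j ∈ Finset.range n, x j * (dv x j - dv x (j+1)) := by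
    apply Finset.sum_congr rfl
    intro j hj
    simp [phi, Finset.mem_range.mp hj]
  have h2 : ∀ m, ∑ j ∈ Finset.range m, x j * (dv x j - dv x (j+1))
      = ∑ j ∈ Finset.range m, (dv x (j+1))^2 - x m * dv x m := by
    intro m
    induction m with
    | zero => simp [dv]
    | succ m ih =>
      rw [Finset.sum_range_succ, Finset.sum_range_succ, ih]
      simp only [dv]; ring
  rw [h1, h2, hx]; ring

lemma col_V (n : ℕ) (x : ℕ → ℝ) :
    ∑ j ∈ Finset.range n, (x (j+1) - x j) * (phi n x (j+1) - phi n x j)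
      = ∑ j ∈ Finset.range n, (dv x (j+1) - dv x j)^2 := by
  have h2 : ∀ (f : ℕ → ℝ) m, ∑ j ∈ Finset.range m, (x (j+1) - x j) * (f (j+1) - f j)
      = ∑ j ∈ Finset.range m, f j * (dv x j - dv x (j+1)) + dv x m * f m := by
    intro f m
    induction m with
    | zero => simp [dv]
    | succ m ih =>
      rw [Finset.sum_range_succ, Finset.sum_range_succ, ih]
      simp only [dv]; ring
  rw [h2]
  have : phi n x n = 0 := by simp [phi]
  rw [this, mul_zero, add_zero]
  apply Finset.sum_congr rfl
  intro j hj
  simp only [phi, Finset.mem_range.mp hj, if_true]; ring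

/-- two neighbouring columns -/
lemma col_H (m : ℕ) (x y : ℕ → ℝ) (hx : x (m+1) = 0) (hy : ∀ j, m ≤ j → y j = 0) :
    ∑ j ∈ Finset.range (m+1), (y j - x j) * (phi m y j - phi (m+1) x j)
      = ∑ j ∈ Finset.range m, (dv y (j+1) - dv x (j+1))^2
        + (x m ^2 - x m * (if m = 0 then 0 else y (m-1))) := by
  have h2 : ∀ k, ∑ j ∈ Finset.range k, (y j - x j) * ((dv y j - dv y (j+1)) - (dv x j - dv x (j+1)))
      = ∑ j ∈ Finset.range k, (dv y (j+1) - dv x (j+1))^2 - (y k - x k) * (dv y k - dv x k) := by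
    intro k
    induction k with
    | zero => simp [dv]
    | succ k ih =>
      rw [Finset.sum_range_succ, Finset.sum_range_succ, ih]
      simp only [dv]; ring
  rw [Finset.sum_range_succ]
  have h1 : ∑ j ∈ Finset.range m, (y j - x j) * (phi m y j - phi (m+1) x j)
     = ∑ j ∈ Finset.range m, (y j - x j) * ((dv y j - dv y (j+1)) - (dv x j - dv x (j+1))) := by
    apply Finset.sum_congr rfl
    intro j hj
    have := Finset.mem_range.mp hj
    simp only [phi, this, if_true, Nat.lt_succ_of_lt this]
  rw [h1, h2]
  have e1 : phi m y m = 0 := by simp [phi]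
  have e2 : phi (m+1) x m = dv x m - dv x (m+1) := by simp [phi]
  rw [e1, e2, hy m le_rfl]
  rcases m with _ | m
  · simp [dv, hx]; ring
  · simp [dv, hx, hy (m+1) le_rfl]; ring

def HH (N : ℕ) (U W : ℕ → ℕ → ℝ) : ℝ := ∑ i ∈ Finset.range N, ∑ j ∈ Finset.range (N - i),
  (U (i+1) j - U i j) * (W (i+1) j - W i j)
def VV (N : ℕ) (U W : ℕ → ℕ → ℝ) : ℝ := ∑ i ∈ Finset.range N, cw i * ∑ j ∈ Finset.range (N - i),
  (U i (j+1) - U i j) * (W i (j+1) - W i j)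
def MM (N : ℕ) (U W : ℕ → ℕ → ℝ) : ℝ := ∑ i ∈ Finset.range N, cw i * ∑ j ∈ Finset.range (N - i),
  U i j * W i j

def HP (N : ℕ) (v : ℕ → ℕ → ℝ) : ℝ := ∑ i ∈ Finset.range N, ∑ j ∈ Finset.range (N - i - 1),
  (v (i+1) (j+1) - v i (j+1))^2
def VP (N : ℕ) (v : ℕ → ℕ → ℝ) : ℝ := ∑ i ∈ Finset.range N, cw i * ∑ j ∈ Finset.range (N - i),
  (v i (j+1) - v i j)^2
def MP (N : ℕ) (v : ℕ → ℕ → ℝ) : ℝ := ∑ i ∈ Finset.range N, cw i * ∑ j ∈ Finset.range (N - i),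
  (v i (j+1))^2

def PH (N : ℕ) (U : ℕ → ℕ → ℝ) (i : ℕ) : ℕ → ℝ := phi (N - i) (U i)

lemma half_M (N : ℕ) (U : ℕ → ℕ → ℝ) (hU : ∀ i j, N ≤ i + j → U i j = 0) :
    MM N U (PH N U) = MP N (fun i => dv (U i)) := by
  unfold MM MP PH
  apply Finset.sum_congr rfl
  intro i hi
  rw [col_M _ _ (hU _ _ (by have := Finset.mem_range.mp hi; omega))]

lemma half_V (N : ℕ) (U : ℕ → ℕ → ℝ) :
    VV N U (PH N U) = VP N (fun i => dv (U i)) := by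
  unfold VV VP PH
  apply Finset.sum_congr rfl
  intro i hi
  rw [col_V]

lemma half_H (N : ℕ) (U : ℕ → ℕ → ℝ) (hU : ∀ i j, N ≤ i + j → U i j = 0) :
    HP N (fun i => dv (U i)) ≤ HH N U (PH N U) := by
  unfold HH HP PH
  let X : ℕ → ℝ := fun i => if i < N then U i (N - i - 1) else 0
  have key : ∑ i ∈ Finset.range N, ∑ j ∈ Finset.range (N - i),
      (U (i+1) j - U i j) * (phi (N - (i+1)) (U (i+1)) j - phi (N - i) (U i) j)
     = ∑ i ∈ Finset.range N, (∑ j ∈ Finset.range (N - i - 1),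
      (dv (U (i+1)) (j+1) - dv (U i) (j+1))^2 + (X i ^2 - X i * X (i+1))) := by
    apply Finset.sum_congr rfl
    intro i hi
    have hi := Finset.mem_range.mp hi
    obtain ⟨m, hm⟩ : ∃ m, N = i + m + 1 := ⟨N - i - 1, by omega⟩
    have a1 : N - i = m + 1 := by omega
    have a2 : N - (i+1) = m := by omega
    rw [a1, a2, col_H m (U i) (U (i+1)) (hU _ _ (by omega)) (fun j hj => hU _ _ (by omega))]
    have : X i = U i m := by simp [X, hi, a1]
    have h3 : X (i+1) = if m = 0 then 0 else U (i+1) (m-1) := by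
      by_cases h : m = 0
      · simp only [X, h, if_true]; rw [if_neg (by omega)]
      · simp only [X, h, if_false]; rw [if_pos (by omega), a2]
    rw [this, h3]; simp
  rw [key, Finset.sum_add_distrib]
  have h4 : ∀ k, 0 ≤ ∑ i ∈ Finset.range k, (X i ^2 - X i * X (i+1)) + X k ^ 2 / 2 := by
    intro k
    induction k with
    | zero => simp; positivity
    | succ k ih => rw [Finset.sum_range_succ]; nlinarith [sq_nonneg (X k - X (k+1))]
  have h5 := h4 N
  have h6 : X N = 0 := by simp [X]
  rw [h6] at h5
  linarith

/-- abstract first eigenvector -/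
lemma exists_eig {X : Type*} [NormedAddCommGroup X] [NormedSpace ℝ X] [FiniteDimensional ℝ X]
    [Nontrivial X] (E M : X → X → ℝ)
    (hE : ∀ u w t, E (u + t • w) (u + t • w) = E u u + 2 * t * E u w + t^2 * E w w)
    (hM : ∀ u w t, M (u + t • w) (u + t • w) = M u u + 2 * t * M u w + t^2 * M w w)
    (hE' : ∀ u (t : ℝ), E (t • u) (t • u) = t^2 * E u u)
    (hM' : ∀ u (t : ℝ), M (t • u) (t • u) = t^2 * M u u)
    (cE : Continuous fun u => E u u) (cM : Continuous fun u => M u u)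
    (pM : ∀ u, u ≠ 0 → 0 < M u u) :
    ∃ (l : ℝ) (u : X), u ≠ 0 ∧ (∀ w, E u w = l * M u w) ∧ ∀ w, l * M w w ≤ E w w := by
  have : ProperSpace X := FiniteDimensional.proper ℝ X
  obtain ⟨u, hu, hmin⟩ := (isCompact_sphere (0:X) 1).exists_isMinOn
    (NormedSpace.sphere_nonempty.mpr zero_le_one)
    (f := fun u => E u u / M u u) (by
      apply ContinuousOn.div cE.continuousOn cM.continuousOn
      intro x hx
      exact (pM x (by rintro rfl; simp at hx)).ne')
  have hu0 : u ≠ 0 := by rintro rfl; simp at hu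
  have hMu := pM u hu0
  set l := E u u / M u u with hl
  have hEu : E u u = l * M u u := by rw [hl]; field_simp
  have hall : ∀ w, l * M w w ≤ E w w := by
    intro w
    by_cases hw : w = 0
    · subst hw
      have h1 := hE' 0 0; have h2 := hM' 0 0
      simp at h1 h2; simp [h1, h2]
    · have hn : ‖w‖ ≠ 0 := norm_ne_zero_iff.mpr hw
      have := hmin (a := ‖w‖⁻¹ • w) (by simp [norm_smul, hn])
      simp only [Set.mem_ofPred_eq] at this
      rw [hE', hM', mul_div_mul_left _ _ (by positivity)] at this
      rwa [← hl, le_div_iff₀ (pM w hw)] at this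
  refine ⟨l, u, hu0, ?_, hall⟩
  intro w
  have hq : ∀ t : ℝ, 0 ≤ (E w w - l * M w w) * (t * t) + (2 * (E u w - l * M u w)) * t + 0 := by
    intro t
    have := hall (u + t • w)
    rw [hE, hM, hEu] at this
    nlinarith
  have := discrim_le_zero hq
  unfold discrim at this
  nlinarith [sq_nonneg (E u w - l * M u w)]

lemma HH_quad (N : ℕ) (U W : ℕ → ℕ → ℝ) (t : ℝ) :
    HH N (fun i j => U i j + t * W i j) (fun i j => U i j + t * W i j)
      = HH N U U + 2 * t * HH N U W + t^2 * HH N W W := by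
  simp only [HH, Finset.mul_sum, ← Finset.sum_add_distrib]
  refine Finset.sum_congr rfl fun i _ => Finset.sum_congr rfl fun j _ => ?_
  ring
lemma VV_quad (N : ℕ) (U W : ℕ → ℕ → ℝ) (t : ℝ) :
    VV N (fun i j => U i j + t * W i j) (fun i j => U i j + t * W i j)
      = VV N U U + 2 * t * VV N U W + t^2 * VV N W W := by
  simp only [VV, Finset.mul_sum, ← Finset.sum_add_distrib]
  refine Finset.sum_congr rfl fun i _ => Finset.sum_congr rfl fun j _ => ?_
  ring
lemma MM_quad (N : ℕ) (U W : ℕ → ℕ → ℝ) (t : ℝ) :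
    MM N (fun i j => U i j + t * W i j) (fun i j => U i j + t * W i j)
      = MM N U U + 2 * t * MM N U W + t^2 * MM N W W := by
  simp only [MM, Finset.mul_sum, ← Finset.sum_add_distrib]
  refine Finset.sum_congr rfl fun i _ => Finset.sum_congr rfl fun j _ => ?_
  ring

lemma cw_pos (i : ℕ) : 0 < cw i := by unfold cw; split_ifs <;> norm_num

lemma MM_nonneg (N : ℕ) (U : ℕ → ℕ → ℝ) : 0 ≤ MM N U U := by
  unfold MM
  exact Finset.sum_nonneg fun i _ => mul_nonneg (cw_pos i).le
    (Finset.sum_nonneg fun j _ => mul_self_nonneg _)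
lemma MP_nonneg (N : ℕ) (U : ℕ → ℕ → ℝ) : 0 ≤ MP N U := by
  unfold MP
  exact Finset.sum_nonneg fun i _ => mul_nonneg (cw_pos i).le
    (Finset.sum_nonneg fun j _ => sq_nonneg _)

lemma MM_eq_zero (N : ℕ) (U : ℕ → ℕ → ℝ) (h : MM N U U = 0) (i j : ℕ) (hij : i + j < N) :
    U i j = 0 := by
  unfold MM at h
  rw [Finset.sum_eq_zero_iff_of_nonneg (fun i _ => mul_nonneg (cw_pos i).le
    (Finset.sum_nonneg fun j _ => mul_self_nonneg _))] at h
  have h1 := h i (Finset.mem_range.mpr (by omega))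
  rw [mul_eq_zero, or_iff_right (cw_pos i).ne',
    Finset.sum_eq_zero_iff_of_nonneg (fun j _ => mul_self_nonneg _)] at h1
  exact mul_self_eq_zero.mp (h1 j (Finset.mem_range.mpr (by omega)))

lemma MP_eq_zero (N : ℕ) (U : ℕ → ℕ → ℝ) (h : MP N U = 0) (i j : ℕ) (hij : i + j < N) :
    U i (j+1) = 0 := by
  unfold MP at h
  rw [Finset.sum_eq_zero_iff_of_nonneg (fun i _ => mul_nonneg (cw_pos i).le
    (Finset.sum_nonneg fun j _ => sq_nonneg _))] at h
  have h1 := h i (Finset.mem_range.mpr (by omega))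
  rw [mul_eq_zero, or_iff_right (cw_pos i).ne',
    Finset.sum_eq_zero_iff_of_nonneg (fun j _ => sq_nonneg _)] at h1
  exact pow_eq_zero_iff (two_ne_zero) |>.mp (h1 j (Finset.mem_range.mpr (by omega)))

lemma dv_zero (N : ℕ) (x : ℕ → ℝ) (hx : x N = 0) (h : ∀ j, j < N → dv x (j+1) = 0) (j : ℕ)
    (hj : j ≤ N) : x j = 0 := by
  induction hk : N - j generalizing j with
  | zero => have : j = N := by omega
            rw [this, hx]
  | succ k ih =>
    have h1 := ih (j+1) (by omega) (by omega)
    have h2 := h j (by omega)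
    simp only [dv] at h2
    linarith

abbrev IX (N : ℕ) := {z : ℤ × ℕ // z.1.natAbs + z.2 < N}

instance (N : ℕ) : Finite (IX N) := by
  apply Set.Finite.subset (s := (Set.Icc (-(N:ℤ)) N) ×ˢ (Set.Iio N)) ((Set.finite_Icc _ _).prod (Set.finite_Iio _))
  rintro ⟨i, j⟩ h
  have h : i.natAbs + j < N := h
  simp only [Set.mem_prod, Set.mem_Icc, Set.mem_Iio]
  omega

instance (N : ℕ) : Fintype (IX N) := Fintype.ofFinite _

def exr (N : ℕ) (c : IX N → ℝ) (i : ℤ) (j : ℕ) : ℝ :=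
  if h : i.natAbs + j < N then c ⟨(i, j), h⟩ else 0

lemma exr_cont (N : ℕ) (i : ℤ) (j : ℕ) : Continuous fun c => exr N c i j := by
  unfold exr
  split_ifs <;> fun_prop

def Rr (N : ℕ) (c : IX N → ℝ) (i j : ℕ) : ℝ := exr N c i j
def Lr (N : ℕ) (c : IX N → ℝ) (i j : ℕ) : ℝ := exr N c (-(i:ℤ)) j

lemma Rr_cont (N : ℕ) (i j : ℕ) : Continuous fun c => Rr N c i j := exr_cont _ _ _
lemma Lr_cont (N : ℕ) (i j : ℕ) : Continuous fun c => Lr N c i j := exr_cont _ _ _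

lemma Rr_add (N : ℕ) (c d : IX N → ℝ) (t : ℝ) :
    Rr N (c + t • d) = fun i j => Rr N c i j + t * Rr N d i j := by
  funext i j; simp only [Rr, exr]; split_ifs <;> simp
lemma Lr_add (N : ℕ) (c d : IX N → ℝ) (t : ℝ) :
    Lr N (c + t • d) = fun i j => Lr N c i j + t * Lr N d i j := by
  funext i j; simp only [Lr, exr]; split_ifs <;> simp

lemma exists_IX (N : ℕ) (U W : ℕ → ℕ → ℝ) (hU : ∀ i j, N ≤ i + j → U i j = 0)
    (hW : ∀ i j, N ≤ i + j → W i j = 0) (h0 : U 0 = W 0) :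
    ∃ c, Rr N c = U ∧ Lr N c = W := by
  refine ⟨fun z => if 0 ≤ z.1.1 then U z.1.1.natAbs z.1.2 else W z.1.1.natAbs z.1.2, ?_, ?_⟩
  · funext i j
    simp only [Rr, exr]
    split_ifs with h1 h2
    · simp
    · simp at h2
    · rw [hU]; simp at h1; omega
  · funext i j
    simp only [Lr, exr]
    split_ifs with h1 h2
    · have : i = 0 := by simp at h2; omega
      subst this; simp [h0]
    · simp
    · rw [hW]; simp at h1; omega

def EE (p q h : ℝ) (N : ℕ) (U W U' W' : ℕ → ℕ → ℝ) : ℝ :=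
  (h/q * HH N U U' + q/h * VV N U U') + (h/p * HH N W W' + p/h * VV N W W')
def ME (p q : ℝ) (N : ℕ) (U W U' W' : ℕ → ℕ → ℝ) : ℝ := q * MM N U U' + p * MM N W W'

lemma discrete_main (p q h : ℝ) (hp : 0 < p) (hq : 0 < q) (hh : 0 < h) (N : ℕ) (hN : 0 < N) :
    ∃ (l : ℝ) (v w : ℕ → ℕ → ℝ), (∀ i, v i 0 = 0) ∧ (∀ i, w i 0 = 0) ∧ v 0 = w 0 ∧
      0 < q * MP N v + p * MP N w ∧
      (h/q * HP N v + q/h * VP N v) + (h/p * HP N w + p/h * VP N w)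
        ≤ l * (q * MP N v + p * MP N w) ∧
      ∀ U W : ℕ → ℕ → ℝ, (∀ i j, N ≤ i + j → U i j = 0) → (∀ i j, N ≤ i + j → W i j = 0) →
        U 0 = W 0 → l * ME p q N U W U W ≤ EE p q h N U W U W := by
  have : Nonempty (IX N) := ⟨⟨(0,0), by simpa using hN⟩⟩
  have q0 : ∀ c : IX N → ℝ, ∀ t : ℝ, t • c = (0 : IX N → ℝ) + t • c := by intros; simp
  have R0 : Rr N 0 = fun _ _ => 0 := by funext i j; simp [Rr, exr]
  have L0 : Lr N 0 = fun _ _ => 0 := by funext i j; simp [Lr, exr]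
  have ind : ∀ c : IX N → ℝ, Rr N c = (fun _ _ => 0) → Lr N c = (fun _ _ => 0) → c = 0 := by
    intro c h1 h2
    funext ⟨⟨i, j⟩, hz⟩
    have hz' : i.natAbs + j < N := hz
    rcases Int.natAbs_eq i with hi | hi
    · have := congrFun (congrFun h1 i.natAbs) j
      simp only [Rr, exr] at this
      rw [← hi] at this
      simpa [hz'] using this
    · have := congrFun (congrFun h2 i.natAbs) j
      simp only [Lr, exr] at this
      rw [← hi] at this
      simpa [hz'] using this
  have Rs : ∀ c i j, N ≤ i + j → Rr N c i j = 0 := by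
    intro c i j hij; simp only [Rr, exr]; rw [dif_neg]; simp; omega
  have Ls : ∀ c i j, N ≤ i + j → Lr N c i j = 0 := by
    intro c i j hij; simp only [Lr, exr]; rw [dif_neg]; simp; omega
  have RL : ∀ c, Rr N c 0 = Lr N c 0 := by intro c; funext j; simp [Rr, Lr]
  obtain ⟨l, u, hu, heig, hmin⟩ := exists_eig (X := IX N → ℝ)
    (fun c d => EE p q h N (Rr N c) (Lr N c) (Rr N d) (Lr N d))
    (fun c d => ME p q N (Rr N c) (Lr N c) (Rr N d) (Lr N d))
    (by intro u w t; simp only [EE, Rr_add, Lr_add, HH_quad, VV_quad]; ring)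
    (by intro u w t; simp only [ME, Rr_add, Lr_add, MM_quad]; ring)
    (by intro u t; rw [q0 u t]; simp only [EE, Rr_add, Lr_add, HH_quad, VV_quad, R0, L0]
        simp [HH, VV]; ring)
    (by intro u t; rw [q0 u t]; simp only [ME, Rr_add, Lr_add, MM_quad, R0, L0]
        simp [MM]; ring)
    (by
      have := Rr_cont N; have := Lr_cont N
      simp only [EE, HH, VV]; fun_prop)
    (by
      have := Rr_cont N; have := Lr_cont N
      simp only [ME, MM]; fun_prop)
    (by
      intro u hu
      simp only [ME]
      by_contra hcon
      have m1 := MM_nonneg N (Rr N u)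
      have m2 := MM_nonneg N (Lr N u)
      have m3 := mul_nonneg hq.le m1
      have m4 := mul_nonneg hp.le m2
      have z1 : MM N (Rr N u) (Rr N u) = 0 := by
        have : q * MM N (Rr N u) (Rr N u) = 0 := by linarith
        simpa [hq.ne'] using this
      have z2 : MM N (Lr N u) (Lr N u) = 0 := by
        have : p * MM N (Lr N u) (Lr N u) = 0 := by linarith
        simpa [hp.ne'] using this
      apply hu
      apply ind
      · funext i j
        by_cases hij : i + j < N
        · exact MM_eq_zero N _ z1 i j hij
        · exact Rs _ _ _ (by omega)
      · funext i j
        by_cases hij : i + j < N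
        · exact MM_eq_zero N _ z2 i j hij
        · exact Ls _ _ _ (by omega))
  have ps : ∀ U : ℕ → ℕ → ℝ, ∀ i j, N ≤ i + j → PH N U i j = 0 := by
    intro U i j hij; simp only [PH, phi]; rw [if_neg (by omega)]
  obtain ⟨c, hc1, hc2⟩ := exists_IX N (PH N (Rr N u)) (PH N (Lr N u)) (ps _) (ps _)
    (by simp only [PH, RL])
  refine ⟨l, fun i => dv (Rr N u i), fun i => dv (Lr N u i), fun i => rfl, fun i => rfl,
    by simp only [RL], ?_, ?_, ?_⟩
  · by_contra hcon
    have m1 := MP_nonneg N (fun i => dv (Rr N u i))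
    have m2 := MP_nonneg N (fun i => dv (Lr N u i))
    have m3 := mul_nonneg hq.le m1
    have m4 := mul_nonneg hp.le m2
    have z1 : MP N (fun i => dv (Rr N u i)) = 0 := by
      have : q * MP N (fun i => dv (Rr N u i)) = 0 := by linarith
      simpa [hq.ne'] using this
    have z2 : MP N (fun i => dv (Lr N u i)) = 0 := by
      have : p * MP N (fun i => dv (Lr N u i)) = 0 := by linarith
      simpa [hp.ne'] using this
    apply hu
    apply ind
    · funext i j
      by_cases hij : i + j < N
      · exact dv_zero (N - i) _ (Rs _ _ _ (by omega))
          (fun k hk => MP_eq_zero N _ z1 i k (by omega)) j (by omega)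
      · exact Rs _ _ _ (by omega)
    · funext i j
      by_cases hij : i + j < N
      · exact dv_zero (N - i) _ (Ls _ _ _ (by omega))
          (fun k hk => MP_eq_zero N _ z2 i k (by omega)) j (by omega)
      · exact Ls _ _ _ (by omega)
  · have := heig c
    simp only [EE, ME, hc1, hc2, half_M N _ (Rs u), half_M N _ (Ls u), half_V] at this
    rw [← this]
    have a1 := half_H N _ (Rs u)
    have a2 := half_H N _ (Ls u)
    gcongr
  · intro U W hU hW h0
    obtain ⟨c, h1, h2⟩ := exists_IX N U W hU hW h0
    have := hmin c
    simpa only [h1, h2] using this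

def TH (q h : ℝ) : Set (ℝ × ℝ) := {z | 0 < z.1 ∧ 0 < z.2 ∧ z.1 / q + z.2 / h < 1}

lemma TH_open (q h : ℝ) : IsOpen (TH q h) := by
  have h1 : IsOpen {z : ℝ × ℝ | 0 < z.1} := isOpen_lt continuous_const continuous_fst
  have h2 : IsOpen {z : ℝ × ℝ | 0 < z.2} := isOpen_lt continuous_const continuous_snd
  have h3 : IsOpen {z : ℝ × ℝ | z.1 / q + z.2 / h < 1} :=
    isOpen_lt (by fun_prop) continuous_const
  exact h1.inter (h2.inter h3)

lemma ae_fst_ne (c : ℝ) : ∀ᵐ z : ℝ × ℝ, z.1 ≠ c := by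
  have : MeasurableSet {z : ℝ × ℝ | z.1 = c} := (isClosed_eq continuous_fst continuous_const).measurableSet
  rw [ae_iff]
  simp only [not_not, Measure.volume_eq_prod]
  have h2 : {z : ℝ × ℝ | z.1 = c} = {c} ×ˢ Set.univ := by ext z; simp
  rw [h2, Measure.prod_prod]; simp

lemma ae_snd_ne (c : ℝ) : ∀ᵐ z : ℝ × ℝ, z.2 ≠ c := by
  rw [ae_iff]
  simp only [not_not, Measure.volume_eq_prod]
  have h2 : {z : ℝ × ℝ | z.2 = c} = Set.univ ×ˢ {c} := by ext z; simp
  rw [h2, Measure.prod_prod]; simp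

lemma ae_line_ne (q h : ℝ) (hh : 0 < h) : ∀ᵐ z : ℝ × ℝ, z.1 / q + z.2 / h ≠ 1 := by
  rw [ae_iff]
  simp only [not_not, Measure.volume_eq_prod]
  have hm : MeasurableSet {z : ℝ × ℝ | z.1 / q + z.2 / h = 1} :=
    (isClosed_eq (by fun_prop) continuous_const).measurableSet
  rw [Measure.measure_prod_null hm]
  refine Filter.Eventually.of_forall fun x => ?_
  refine measure_mono_null (t := {h * (1 - x / q)}) ?_ (by simp)
  intro y hy
  simp only [Set.mem_preimage, Set.mem_ofPred_eq] at hy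
  simp only [Set.mem_singleton_iff]
  have hy2 : y / h = 1 - x / q := by linarith
  rw [← hy2]; field_simp

def cell (a b : ℝ) (i j : ℕ) : Set (ℝ × ℝ) :=
  Set.Ico (i * a) ((i + 1) * a) ×ˢ Set.Ico (j * b) ((j + 1) * b)

lemma cell_meas (a b : ℝ) (i j : ℕ) : MeasurableSet (cell a b i j) :=
  measurableSet_Ico.prod measurableSet_Ico

lemma cell_vol (a b : ℝ) (ha : 0 < a) (hb : 0 < b) (i j : ℕ) :
    (volume : Measure (ℝ × ℝ)).real (cell a b i j) = a * b := by
  unfold cell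
  rw [Measure.volume_eq_prod, measureReal_prod_prod, Real.volume_real_Ico_of_le (by nlinarith),
    Real.volume_real_Ico_of_le (by nlinarith)]
  ring

lemma mem_cell (a b : ℝ) (ha : 0 < a) (hb : 0 < b) (i j : ℕ) (z : ℝ × ℝ) :
    z ∈ cell a b i j ↔ (0 ≤ z.1 ∧ 0 ≤ z.2) ∧ i = ⌊z.1 / a⌋₊ ∧ j = ⌊z.2 / b⌋₊ := by
  unfold cell
  simp only [Set.mem_prod, Set.mem_Ico]
  constructor
  · rintro ⟨⟨h1, h2⟩, h3, h4⟩
    have hi : (0:ℝ) ≤ i := Nat.cast_nonneg i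
    have hj : (0:ℝ) ≤ j := Nat.cast_nonneg j
    have z1 : 0 ≤ z.1 := by nlinarith
    have z2 : 0 ≤ z.2 := by nlinarith
    refine ⟨⟨z1, z2⟩, ?_, ?_⟩
    · symm; rw [Nat.floor_eq_iff (by positivity)]
      exact ⟨by rwa [le_div_iff₀ ha], by rwa [div_lt_iff₀ ha]⟩
    · symm; rw [Nat.floor_eq_iff (by positivity)]
      exact ⟨by rwa [le_div_iff₀ hb], by rwa [div_lt_iff₀ hb]⟩
  · rintro ⟨⟨z1, z2⟩, h1, h2⟩
    have h1 := (Nat.floor_eq_iff (by positivity)).mp h1.symm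
    have h2 := (Nat.floor_eq_iff (by positivity)).mp h2.symm
    rw [le_div_iff₀ ha, div_lt_iff₀ ha] at h1
    rw [le_div_iff₀ hb, div_lt_iff₀ hb] at h2
    exact ⟨h1, h2⟩

def stepf (a b : ℝ) (N : ℕ) (F : ℕ → ℕ → ℝ) (z : ℝ × ℝ) : ℝ :=
  ∑ i ∈ Finset.range N, ∑ j ∈ Finset.range (N - i), (cell a b i j).indicator (fun _ => F i j) z

lemma stepf_apply (a b : ℝ) (ha : 0 < a) (hb : 0 < b) (N : ℕ) (F : ℕ → ℕ → ℝ) (z : ℝ × ℝ) :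
    stepf a b N F z = if (0 ≤ z.1 ∧ 0 ≤ z.2) ∧ ⌊z.1 / a⌋₊ + ⌊z.2 / b⌋₊ < N
      then F ⌊z.1 / a⌋₊ ⌊z.2 / b⌋₊ else 0 := by
  classical
  unfold stepf
  simp only [Set.indicator_apply, mem_cell a b ha hb]
  by_cases h0 : 0 ≤ z.1 ∧ 0 ≤ z.2
  · simp only [h0, true_and, ite_and]
    have : ∀ i, (∑ j ∈ Finset.range (N - i), if i = ⌊z.1 / a⌋₊ then (if j = ⌊z.2 / b⌋₊ then F i j else 0) else 0)
       = if i = ⌊z.1 / a⌋₊ then (if ⌊z.2/b⌋₊ < N - i then F i ⌊z.2/b⌋₊ else 0) else 0 := by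
      intro i
      split_ifs with h1 h2
      · rw [Finset.sum_ite_eq']; simp only [Finset.mem_range, h2, if_true]
      · rw [Finset.sum_ite_eq']; simp only [Finset.mem_range, h2, if_false]
      · simp
    simp only [this]
    rw [Finset.sum_ite_eq']
    simp only [Finset.mem_range, if_true]
    split_ifs <;> first | rfl | omega
  · simp [h0]

lemma stepf_integral (a b : ℝ) (ha : 0 < a) (hb : 0 < b) (N : ℕ) (F : ℕ → ℕ → ℝ) :
    ∫ z, stepf a b N F z = ∑ i ∈ Finset.range N, ∑ j ∈ Finset.range (N - i), a * b * F i j := by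
  have hfin : ∀ i j, volume (cell a b i j) ≠ ⊤ := by
    intro i j
    unfold cell
    rw [Measure.volume_eq_prod, Measure.prod_prod]
    simp [ENNReal.mul_eq_top]
  have hint : ∀ i j, Integrable ((cell a b i j).indicator (fun _ => F i j)) := by
    intro i j
    rw [integrable_indicator_iff (cell_meas _ _ _ _)]
    exact integrableOn_const (hfin i j)
  unfold stepf
  rw [integral_finsetSum _ (fun i _ => integrable_finsetSum _ (fun j _ => hint i j))]
  refine Finset.sum_congr rfl fun i _ => ?_
  rw [integral_finsetSum _ (fun j _ => hint i j)]
  refine Finset.sum_congr rfl fun j _ => ?_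
  rw [integral_indicator_const _ (cell_meas _ _ _ _), cell_vol a b ha hb]
  rfl

lemma stepf_meas (a b : ℝ) (N : ℕ) (F : ℕ → ℕ → ℝ) : Measurable (stepf a b N F) := by
  unfold stepf
  refine Finset.measurable_sum _ fun i _ => Finset.measurable_sum _ fun j _ => ?_
  exact measurable_const.indicator (cell_meas _ _ _ _)

lemma riemann (q h : ℝ) (hq : 0 < q) (hh : 0 < h) (F : ℕ → ℕ → ℕ → ℝ) (K : ℝ)
    (hK : ∀ N i j, i + j < N → |F N i j| ≤ K) (g : ℝ × ℝ → ℝ)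
    (hg : ∀ z ∈ TH q h, Tendsto (fun N : ℕ => F N ⌊z.1 / (q / (N + 1/2))⌋₊ ⌊z.2 / (h / (N + 1/2))⌋₊)
      atTop (𝓝 (g z))) :
    Tendsto (fun N : ℕ => ∑ i ∈ Finset.range N, ∑ j ∈ Finset.range (N - i),
      (q / (N + 1/2)) * (h / (N + 1/2)) * F N i j) atTop (𝓝 (∫ z in TH q h, g z)) := by
  have hs : ∀ N : ℕ, (0:ℝ) < N + 1/2 := fun N => by positivity
  rw [← integral_indicator (TH_open q h).measurableSet]
  have e : ∀ N : ℕ, ∑ i ∈ Finset.range N, ∑ j ∈ Finset.range (N - i),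
      (q / (N + 1/2)) * (h / (N + 1/2)) * F N i j
      = ∫ z, stepf (q / (N + 1/2)) (h / (N + 1/2)) N (F N) z := fun N =>
    (stepf_integral _ _ (div_pos hq (hs N)) (div_pos hh (hs N)) N (F N)).symm
  simp only [e]
  have hK0 : 0 ≤ K := (abs_nonneg _).trans (hK 1 0 0 (by norm_num))
  have hdd : ∀ (x q : ℝ) (N : ℕ), x / (q / (N + 1/2)) = x / q * (N + 1/2) := by
    intro x q N; rw [div_div_eq_mul_div]; ring
  apply tendsto_integral_of_dominated_convergence
    ((Set.Icc 0 q ×ˢ Set.Icc 0 h).indicator (fun _ => K))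
  · intro N; exact (stepf_meas _ _ _ _).aestronglyMeasurable
  · rw [integrable_indicator_iff (measurableSet_Icc.prod measurableSet_Icc)]
    refine integrableOn_const ?_
    rw [Measure.volume_eq_prod, Measure.prod_prod]
    simp [ENNReal.mul_eq_top]
  · intro N
    refine Eventually.of_forall fun z => ?_
    rw [stepf_apply _ _ (div_pos hq (hs N)) (div_pos hh (hs N))]
    split_ifs with hc
    · obtain ⟨⟨z1, z2⟩, hc⟩ := hc
      rw [Set.indicator_of_mem]
      · exact hK _ _ _ hc
      · have f1 := Nat.lt_floor_add_one (z.1 / (q / ((N:ℝ) + 1/2)))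
        have f2 := Nat.lt_floor_add_one (z.2 / (h / ((N:ℝ) + 1/2)))
        have hc' : (⌊z.1 / (q / ((N:ℝ) + 1/2))⌋₊ : ℝ) + ⌊z.2 / (h / ((N:ℝ) + 1/2))⌋₊ + 1 ≤ N := by
          exact_mod_cast hc
        have g1 : (0:ℝ) ≤ ⌊z.1 / (q / ((N:ℝ) + 1/2))⌋₊ := Nat.cast_nonneg _
        have g2 : (0:ℝ) ≤ ⌊z.2 / (h / ((N:ℝ) + 1/2))⌋₊ := Nat.cast_nonneg _
        rw [hdd] at f1 f2 hc' g1 g2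
        rw [hdd] at hc'
        refine ⟨⟨z1, ?_⟩, z2, ?_⟩
        · have : z.1 / q * (N + 1/2) ≤ 1 * (N + 1/2) := by linarith
          have := le_of_mul_le_mul_right this (hs N)
          rwa [div_le_one hq] at this
        · have : z.2 / h * (N + 1/2) ≤ 1 * (N + 1/2) := by linarith
          have := le_of_mul_le_mul_right this (hs N)
          rwa [div_le_one hh] at this
    · simp only [norm_zero]
      exact Set.indicator_nonneg (fun _ _ => hK0) z
  · filter_upwards [ae_fst_ne 0, ae_snd_ne 0, ae_line_ne q h hh] with z n1 n2 n3
    have htop : Tendsto (fun N : ℕ => (N:ℝ)) atTop atTop := tendsto_natCast_atTop_atTop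
    by_cases hz : z ∈ TH q h
    · rw [Set.indicator_of_mem hz]
      refine (hg z hz).congr' ?_
      obtain ⟨z1, z2, z3⟩ := hz
      have hev : ∀ᶠ N : ℕ in atTop, 1 / (1 - (z.1/q + z.2/h)) ≤ (N:ℝ) := htop.eventually_ge_atTop _
      filter_upwards [hev] with N hN
      rw [stepf_apply _ _ (div_pos hq (hs N)) (div_pos hh (hs N)), if_pos]
      refine ⟨⟨z1.le, z2.le⟩, ?_⟩
      have f1 := Nat.floor_le (a := z.1 / (q / ((N:ℝ) + 1/2)))
        (div_nonneg z1.le (div_pos hq (hs N)).le)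
      have f2 := Nat.floor_le (a := z.2 / (h / ((N:ℝ) + 1/2)))
        (div_nonneg z2.le (div_pos hh (hs N)).le)
      have : (⌊z.1 / (q / ((N:ℝ) + 1/2))⌋₊ : ℝ) + ⌊z.2 / (h / ((N:ℝ) + 1/2))⌋₊ < N := by
        refine lt_of_le_of_lt (add_le_add f1 f2) ?_
        rw [hdd, hdd]
        rw [div_le_iff₀ (by linarith)] at hN
        nlinarith
      exact_mod_cast this
    · rw [Set.indicator_of_notMem hz]
      refine tendsto_const_nhds.congr' ?_
      by_cases hz1 : z.1 < 0
      · refine Eventually.of_forall fun N => ?_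
        beta_reduce
        rw [stepf_apply _ _ (div_pos hq (hs N)) (div_pos hh (hs N)), if_neg]
        rintro ⟨⟨h1, _⟩, _⟩; linarith
      by_cases hz2 : z.2 < 0
      · refine Eventually.of_forall fun N => ?_
        beta_reduce
        rw [stepf_apply _ _ (div_pos hq (hs N)) (div_pos hh (hs N)), if_neg]
        rintro ⟨⟨_, h1⟩, _⟩; linarith
      have z1 : 0 < z.1 := lt_of_le_of_ne (not_lt.mp hz1) (Ne.symm n1)
      have z2 : 0 < z.2 := lt_of_le_of_ne (not_lt.mp hz2) (Ne.symm n2)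
      have z3 : 1 < z.1/q + z.2/h := by
        refine lt_of_le_of_ne ?_ (Ne.symm n3)
        by_contra hc
        exact hz ⟨z1, z2, not_le.mp hc⟩
      have hev : ∀ᶠ N : ℕ in atTop, 2 / ((z.1/q + z.2/h) - 1) ≤ (N:ℝ) := htop.eventually_ge_atTop _
      filter_upwards [hev] with N hN
      rw [stepf_apply _ _ (div_pos hq (hs N)) (div_pos hh (hs N)), if_neg]
      rintro ⟨_, hc⟩
      have f1 := Nat.lt_floor_add_one (z.1 / (q / ((N:ℝ) + 1/2)))
      have f2 := Nat.lt_floor_add_one (z.2 / (h / ((N:ℝ) + 1/2)))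
      have hc' : (⌊z.1 / (q / ((N:ℝ) + 1/2))⌋₊ : ℝ) + ⌊z.2 / (h / ((N:ℝ) + 1/2))⌋₊ + 1 ≤ N := by
        exact_mod_cast hc
      have : z.1 / (q / ((N:ℝ) + 1/2)) + z.2 / (h / ((N:ℝ) + 1/2)) < N + 1 := by linarith
      rw [hdd, hdd] at this
      rw [div_le_iff₀ (by linarith)] at hN
      nlinarith

def TC (q h : ℝ) : Set (ℝ × ℝ) := {z | 0 ≤ z.1 ∧ 0 ≤ z.2 ∧ z.1 / q + z.2 / h ≤ 1}

lemma strict_quot (f : ℝ × ℝ → ℝ) (f' : ℝ × ℝ →L[ℝ] ℝ) (z e : ℝ × ℝ) (hf : HasStrictFDerivAt f f' z)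
    (x : ℕ → ℝ × ℝ) (t : ℕ → ℝ) (hx : Tendsto x atTop (𝓝 z)) (ht : Tendsto t atTop (𝓝 0))
    (htp : ∀ n, 0 < t n) :
    Tendsto (fun n => (f (x n + t n • e) - f (x n)) / t n) atTop (𝓝 (f' e)) := by
  have h1 : Tendsto (fun n => (x n + t n • e, x n)) atTop (𝓝 (z, z)) := by
    apply Tendsto.prodMk_nhds _ hx
    have := hx.add (ht.smul_const e)
    simpa using this
  have h2 := hf.isLittleO.comp_tendsto h1
  have h3 : (fun n => f (x n + t n • e) - f (x n) - t n * f' e) =o[atTop] (fun n => t n) := by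
    have h4 : (fun n => t n • e) =O[atTop] (fun n => t n) := by
      apply Asymptotics.IsBigO.of_bound ‖e‖
      refine Eventually.of_forall fun n => ?_
      rw [norm_smul, mul_comm]
    refine Asymptotics.IsLittleO.trans_isBigO ?_ h4
    refine h2.congr ?_ ?_
    · intro n; simp
    · intro n; simp
  have h5 := h3.tendsto_div_nhds_zero
  have h6 := h5.add_const (f' e)
  simp only [zero_add] at h6
  refine h6.congr fun n => ?_
  have := (htp n).ne'
  field_simp
  ring

def smp (q h : ℝ) (w : ℝ × ℝ → ℝ) (N : ℕ) (i j : ℕ) : ℝ :=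
  if i + j < N then w (i * (q / (N + 1/2)), (j + 1/2) * (h / (N + 1/2))) else 0

lemma node_mem (q h : ℝ) (hq : 0 < q) (hh : 0 < h) (N i j : ℕ) (hij : i + j ≤ N) :
    ((i * (q / (N + 1/2)), (j + 1/2) * (h / (N + 1/2))) : ℝ × ℝ) ∈ TC q h := by
  have hs : (0:ℝ) < N + 1/2 := by positivity
  refine ⟨by positivity, by positivity, ?_⟩
  have : (i:ℝ) + j ≤ N := by exact_mod_cast hij
  simp only
  have e : (i:ℝ) * (q / (N + 1/2)) / q + (j + 1/2) * (h / (N + 1/2)) / h = (i + j + 1/2) / (N + 1/2) := by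
    field_simp; ring
  rw [e, div_le_one hs]; linarith

lemma smp_eq (q h : ℝ) (hq : 0 < q) (hh : 0 < h) (w : ℝ × ℝ → ℝ)
    (h0 : ∀ z ∈ TC q h, z.1 / q + z.2 / h = 1 → w z = 0) (N i j : ℕ) (hij : i + j ≤ N) :
    smp q h w N i j = w (i * (q / (N + 1/2)), (j + 1/2) * (h / (N + 1/2))) := by
  unfold smp
  split_ifs with hc
  · rfl
  · rw [h0 _ (node_mem q h hq hh N i j hij)]
    have : i + j = N := by omega
    have h2 : (N:ℝ) = i + j := by exact_mod_cast this.symm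
    have hs : (0:ℝ) < i + j + 1/2 := by positivity
    simp only [h2]
    field_simp; ring

section
variable (q h : ℝ) (hq : 0 < q) (hh : 0 < h) (z : ℝ × ℝ) (hz : z ∈ TH q h)
include hq hh hz

lemma ev_idx : ∀ᶠ N : ℕ in atTop, ⌊z.1 / (q / ((N:ℝ) + 1/2))⌋₊ + ⌊z.2 / (h / ((N:ℝ) + 1/2))⌋₊ < N ∧
    ⌊z.1 / (q / ((N:ℝ) + 1/2))⌋₊ ≠ 0 := by
  have hdd : ∀ (x q : ℝ) (N : ℕ), x / (q / (N + 1/2)) = x / q * (N + 1/2) := by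
    intro x q N; rw [div_div_eq_mul_div]; ring
  have hs : ∀ N : ℕ, (0:ℝ) < N + 1/2 := fun N => by positivity
  have htop : Tendsto (fun N : ℕ => (N:ℝ)) atTop atTop := tendsto_natCast_atTop_atTop
  obtain ⟨z1, z2, z3⟩ := hz
  have hev : ∀ᶠ N : ℕ in atTop, 1 / (1 - (z.1/q + z.2/h)) ≤ (N:ℝ) := htop.eventually_ge_atTop _
  have hev2 : ∀ᶠ N : ℕ in atTop, q / z.1 ≤ (N:ℝ) := htop.eventually_ge_atTop _
  filter_upwards [hev, hev2] with N hN hN2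
  constructor
  · have f1 := Nat.floor_le (a := z.1 / (q / ((N:ℝ) + 1/2)))
      (div_nonneg z1.le (div_pos hq (hs N)).le)
    have f2 := Nat.floor_le (a := z.2 / (h / ((N:ℝ) + 1/2)))
      (div_nonneg z2.le (div_pos hh (hs N)).le)
    have : (⌊z.1 / (q / ((N:ℝ) + 1/2))⌋₊ : ℝ) + ⌊z.2 / (h / ((N:ℝ) + 1/2))⌋₊ < N := by
      refine lt_of_le_of_lt (add_le_add f1 f2) ?_
      rw [hdd, hdd]
      rw [div_le_iff₀ (by linarith)] at hN
      nlinarith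
    exact_mod_cast this
  · rw [Ne, Nat.floor_eq_zero, not_lt, hdd]
    rw [div_le_iff₀ z1] at hN2
    rw [div_mul_eq_mul_div, le_div_iff₀ hq]
    nlinarith

lemma node_tendsto : Tendsto (fun N : ℕ => ((⌊z.1 / (q / ((N:ℝ) + 1/2))⌋₊ * (q / (N + 1/2)),
    (⌊z.2 / (h / ((N:ℝ) + 1/2))⌋₊ + 1/2) * (h / (N + 1/2))) : ℝ × ℝ)) atTop (𝓝 z) := by
  obtain ⟨z1, z2, z3⟩ := hz
  have hs : ∀ N : ℕ, (0:ℝ) < N + 1/2 := fun N => by positivity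
  have ha : ∀ c : ℝ, Tendsto (fun N : ℕ => c / ((N:ℝ) + 1/2)) atTop (𝓝 0) := by
    intro c
    apply tendsto_const_nhds.div_atTop
    exact tendsto_atTop_add_const_right _ _ tendsto_natCast_atTop_atTop
  apply Tendsto.prodMk_nhds
  · have l : Tendsto (fun N : ℕ => z.1 - q / ((N:ℝ) + 1/2)) atTop (𝓝 z.1) := by
      simpa using (ha q).const_sub z.1
    refine tendsto_of_tendsto_of_tendsto_of_le_of_le l tendsto_const_nhds ?_ ?_
    · intro N
      have hp := div_pos hq (hs N)
      have f1 := Nat.lt_floor_add_one (z.1 / (q / ((N:ℝ) + 1/2)))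
      rw [div_lt_iff₀ hp] at f1
      simp only; linarith
    · intro N
      have hp := div_pos hq (hs N)
      have f1 := Nat.floor_le (a := z.1 / (q / ((N:ℝ) + 1/2))) (div_nonneg z1.le hp.le)
      rw [le_div_iff₀ hp] at f1
      exact f1
  · have l : Tendsto (fun N : ℕ => z.2 - h / ((N:ℝ) + 1/2)) atTop (𝓝 z.2) := by
      simpa using (ha h).const_sub z.2
    have l2 : Tendsto (fun N : ℕ => z.2 + h / ((N:ℝ) + 1/2)) atTop (𝓝 z.2) := by
      simpa using (ha h).const_add z.2
    refine tendsto_of_tendsto_of_tendsto_of_le_of_le l l2 ?_ ?_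
    · intro N
      have hp := div_pos hh (hs N)
      have f1 := Nat.lt_floor_add_one (z.2 / (h / ((N:ℝ) + 1/2)))
      rw [div_lt_iff₀ hp] at f1
      simp only; linarith
    · intro N
      have hp := div_pos hh (hs N)
      have f1 := Nat.floor_le (a := z.2 / (h / ((N:ℝ) + 1/2))) (div_nonneg z2.le hp.le)
      rw [le_div_iff₀ hp] at f1
      simp only; linarith
end

lemma cw_le (i : ℕ) : cw i ≤ 1 := by unfold cw; split_ifs <;> norm_num

section
variable (q h : ℝ) (hq : 0 < q) (hh : 0 < h) (w : ℝ × ℝ → ℝ) (K : ℝ) (hK0 : 0 ≤ K)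
    (hL : ∀ z ∈ TC q h, ∀ z' ∈ TC q h, |w z - w z'| ≤ K * ‖z - z'‖)
    (h0 : ∀ z ∈ TC q h, z.1 / q + z.2 / h = 1 → w z = 0)
    (hd : ∀ z ∈ TH q h, HasStrictFDerivAt w (fderiv ℝ w z) z)
include hq hh hK0 hL h0 hd

lemma samp_H : Tendsto (fun N : ℕ => h / q * HH N (smp q h w N) (smp q h w N)) atTop
    (𝓝 (∫ z in TH q h, (fderiv ℝ w z (1, 0))^2)) := by
  have hs : ∀ N : ℕ, (0:ℝ) < N + 1/2 := fun N => by positivity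
  have := riemann q h hq hh
    (fun N i j => ((smp q h w N (i+1) j - smp q h w N i j) / (q / (N + 1/2)))^2) (K^2) ?_
    (fun z => (fderiv ℝ w z (1, 0))^2) ?_
  · refine this.congr fun N => ?_
    unfold HH
    rw [Finset.mul_sum]
    refine Finset.sum_congr rfl fun i _ => ?_
    rw [Finset.mul_sum]
    refine Finset.sum_congr rfl fun j _ => ?_
    have := hs N
    field_simp
  · intro N i j hij
    rw [abs_pow]
    refine pow_le_pow_left₀ (abs_nonneg _) ?_ 2
    have hp := div_pos hq (hs N)
    rw [abs_div, abs_of_pos hp, div_le_iff₀ hp, smp_eq q h hq hh w h0 N (i+1) j (by omega),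
      smp_eq q h hq hh w h0 N i j (by omega)]
    refine (hL _ (node_mem q h hq hh N (i+1) j (by omega)) _ (node_mem q h hq hh N i j (by omega))).trans ?_
    gcongr
    simp only [Prod.norm_def, Prod.fst_sub, Prod.snd_sub, sub_self, norm_zero, Nat.cast_add, Nat.cast_one]
    rw [show ((i:ℝ)+1) * (q / (N + 1/2)) - i * (q / (N + 1/2)) = q / (N + 1/2) by ring,
      Real.norm_of_nonneg hp.le, max_eq_left hp.le]
  · intro z hz
    refine Tendsto.pow ?_ 2
    refine (strict_quot w _ z (1,0) (hd z hz) _ (fun N : ℕ => q / ((N:ℝ) + 1/2)) (node_tendsto q h hq hh z hz)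
      ?_ (fun N => div_pos hq (hs N))).congr' ?_
    · apply tendsto_const_nhds.div_atTop
      exact tendsto_atTop_add_const_right _ _ tendsto_natCast_atTop_atTop
    · filter_upwards [ev_idx q h hq hh z hz] with N hN
      rw [smp_eq q h hq hh w h0 N _ _ (by omega), smp_eq q h hq hh w h0 N _ _ hN.1.le]
      congr 3
      ext <;> simp; ring

lemma samp_V : Tendsto (fun N : ℕ => q / h * VV N (smp q h w N) (smp q h w N)) atTop
    (𝓝 (∫ z in TH q h, (fderiv ℝ w z (0, 1))^2)) := by
  have hs : ∀ N : ℕ, (0:ℝ) < N + 1/2 := fun N => by positivity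
  have := riemann q h hq hh
    (fun N i j => cw i * ((smp q h w N i (j+1) - smp q h w N i j) / (h / (N + 1/2)))^2) (K^2) ?_
    (fun z => (fderiv ℝ w z (0, 1))^2) ?_
  · refine this.congr fun N => ?_
    unfold VV
    rw [Finset.mul_sum]
    refine Finset.sum_congr rfl fun i _ => ?_
    rw [Finset.mul_sum, Finset.mul_sum]
    refine Finset.sum_congr rfl fun j _ => ?_
    have := hs N
    field_simp
  · intro N i j hij
    rw [abs_mul, abs_of_pos (cw_pos i), abs_pow]
    refine (mul_le_of_le_one_left (by positivity) (cw_le i)).trans ?_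
    refine pow_le_pow_left₀ (abs_nonneg _) ?_ 2
    have hp := div_pos hh (hs N)
    rw [abs_div, abs_of_pos hp, div_le_iff₀ hp, smp_eq q h hq hh w h0 N i (j+1) (by omega),
      smp_eq q h hq hh w h0 N i j (by omega)]
    refine (hL _ (node_mem q h hq hh N i (j+1) (by omega)) _ (node_mem q h hq hh N i j (by omega))).trans ?_
    gcongr
    simp only [Prod.norm_def, Prod.fst_sub, Prod.snd_sub, sub_self, norm_zero, Nat.cast_add, Nat.cast_one]
    rw [show ((j:ℝ)+1+1/2) * (h / (N + 1/2)) - (j+1/2) * (h / (N + 1/2)) = h / (N + 1/2) by ring,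
      Real.norm_of_nonneg hp.le, max_eq_right hp.le]
  · intro z hz
    have h1 : Tendsto (fun N : ℕ => cw ⌊z.1 / (q / ((N:ℝ) + 1/2))⌋₊) atTop (𝓝 1) := by
      refine tendsto_const_nhds.congr' ?_
      filter_upwards [ev_idx q h hq hh z hz] with N hN
      simp only [cw, if_neg hN.2]
    have h2 := (strict_quot w _ z (0,1) (hd z hz) _ (fun N : ℕ => h / ((N:ℝ) + 1/2)) (node_tendsto q h hq hh z hz)
      (by apply tendsto_const_nhds.div_atTop
          exact tendsto_atTop_add_const_right _ _ tendsto_natCast_atTop_atTop)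
      (fun N => div_pos hh (hs N))).pow 2
    have h3 := h1.mul h2
    rw [one_mul] at h3
    refine h3.congr' ?_
    · filter_upwards [ev_idx q h hq hh z hz] with N hN
      rw [smp_eq q h hq hh w h0 N _ _ (by omega), smp_eq q h hq hh w h0 N _ _ hN.1.le]
      congr 5
      ext <;> simp; ring

lemma samp_M : Tendsto (fun N : ℕ => h / (N + 1/2)^2 * (q * MM N (smp q h w N) (smp q h w N))) atTop
    (𝓝 (∫ z in TH q h, (w z)^2)) := by
  have hs : ∀ N : ℕ, (0:ℝ) < N + 1/2 := fun N => by positivity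
  have := riemann q h hq hh
    (fun N i j => cw i * (smp q h w N i j)^2) ((K * (q + h))^2) ?_
    (fun z => (w z)^2) ?_
  · refine this.congr fun N => ?_
    unfold MM
    rw [Finset.mul_sum, Finset.mul_sum]
    refine Finset.sum_congr rfl fun i _ => ?_
    rw [Finset.mul_sum, Finset.mul_sum, Finset.mul_sum]
    refine Finset.sum_congr rfl fun j _ => ?_
    have := hs N
    field_simp
  · intro N i j hij
    rw [abs_mul, abs_of_pos (cw_pos i), abs_pow]
    refine (mul_le_of_le_one_left (by positivity) (cw_le i)).trans ?_
    refine pow_le_pow_left₀ (abs_nonneg _) ?_ 2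
    have hqm : ((q, 0) : ℝ × ℝ) ∈ TC q h := ⟨hq.le, le_rfl, by simp [hq.ne']⟩
    have hnm := node_mem q h hq hh N i j hij.le
    have h1 := hL _ hnm _ hqm
    rw [h0 (q,0) hqm (by simp [hq.ne']), sub_zero] at h1
    rw [smp_eq q h hq hh w h0 N i j (by omega)]
    refine h1.trans ?_
    gcongr
    obtain ⟨n1, n2, n3⟩ := hnm
    set z : ℝ × ℝ := (i * (q / (N + 1/2)), (j + 1/2) * (h / (N + 1/2))) with hzdef
    have b1 : z.1 / q ≤ 1 := by have := div_nonneg n2 hh.le; linarith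
    have b2 : z.2 / h ≤ 1 := by have := div_nonneg n1 hq.le; linarith
    rw [div_le_one hq] at b1
    rw [div_le_one hh] at b2
    rw [Prod.norm_def]
    simp only [Prod.fst_sub, Prod.snd_sub, sub_zero, Real.norm_eq_abs]
    rw [max_le_iff]
    constructor
    · rw [abs_le]; constructor <;> linarith
    · rw [abs_le]; constructor <;> linarith
  · intro z hz
    have h1 : Tendsto (fun N : ℕ => cw ⌊z.1 / (q / ((N:ℝ) + 1/2))⌋₊) atTop (𝓝 1) := by
      refine tendsto_const_nhds.congr' ?_
      filter_upwards [ev_idx q h hq hh z hz] with N hN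
      simp only [cw, if_neg hN.2]
    have h2 := ((hd z hz).hasFDerivAt.continuousAt.tendsto.comp (node_tendsto q h hq hh z hz)).pow 2
    have h3 := h1.mul h2
    rw [one_mul] at h3
    refine h3.congr' ?_
    · filter_upwards [ev_idx q h hq hh z hz] with N hN
      rw [smp_eq q h hq hh w h0 N _ _ hN.1.le]
      rfl
end

lemma moll (v : ℝ × ℝ → ℝ) (K : NNReal) (hv : LipschitzWith K v) (hv0 : ∀ z, z.2 ≤ 0 → v z = 0)
    (δ : ℝ) (hδ : 0 < δ) : ∃ u : ℝ × ℝ → ℝ, ContDiff ℝ 1 u ∧ (∀ z, z.2 ≤ 0 → u z = 0) ∧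
      (∀ z, |u z - v z| ≤ K * (2 * δ)) ∧
      ∀ x e c ε, 0 ≤ ε → (∀ t, dist t x < 3 * δ → |v (t + e) - v t - c| ≤ ε) →
        |u (x + e) - u x - c| ≤ ε := by
  let φ : ContDiffBump (0 : ℝ × ℝ) := ⟨δ / 2, δ, by linarith, by linarith⟩
  have hsup : Function.support (φ.normed volume) ⊆ Metric.ball 0 δ := by
    rw [ContDiffBump.support_normed_eq]
  have hnn : ∀ x, 0 ≤ φ.normed volume x := fun x => ContDiffBump.nonneg_normed φ x
  have hint : ∫ x, φ.normed volume x = 1 := ContDiffBump.integral_normed φ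
  have hcs : HasCompactSupport (φ.normed volume) := ContDiffBump.hasCompactSupport_normed φ
  have hcf : Continuous (φ.normed volume) := ContDiffBump.continuous_normed φ
  let d : ℝ × ℝ := (0, δ)
  have hnd : ‖d‖ = δ := by simp [d, Prod.norm_def, abs_of_pos hδ, hδ.le]
  let g : ℝ × ℝ → ℝ := convolution (φ.normed volume) v (ContinuousLinearMap.lsmul ℝ ℝ) volume
  have key : ∀ (m : ℝ × ℝ → ℝ) (hm : Continuous m) (x : ℝ × ℝ) (c ε : ℝ), 0 ≤ ε →
      (∀ t ∈ Metric.ball x δ, |m t - c| ≤ ε) →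
      |convolution (φ.normed volume) m (ContinuousLinearMap.lsmul ℝ ℝ) volume x - c| ≤ ε := by
    intro m hm x c ε hε h
    have := dist_convolution_le (μ := volume) (f := φ.normed volume) (g := m) (x₀ := x) (R := δ)
      (z₀ := c) hε hsup hnn hint hm.aestronglyMeasurable (fun t ht => by
        rw [Real.dist_eq]; exact h t ht)
    rwa [Real.dist_eq] at this
  have hli := hv.continuous.locallyIntegrable (μ := volume)
  have hg : ContDiff ℝ 1 g :=
    hcs.contDiff_convolution_left _ φ.contDiff_normed hli
  refine ⟨fun z => g (z - d), hg.comp (contDiff_id.sub contDiff_const), ?_, ?_, ?_⟩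
  · intro z hz
    have := key v hv.continuous (z - d) 0 0 le_rfl (fun t ht => ?_)
    · simpa using this
    · rw [hv0 t]; · simp
      rw [Metric.mem_ball, dist_eq_norm] at ht
      have h2 := lt_of_le_of_lt (norm_snd_le (t - (z - d))) ht
      rw [Real.norm_eq_abs, abs_lt] at h2
      simp [d] at h2
      linarith
  · intro z
    refine key v hv.continuous (z - d) (v z) _ (by positivity) (fun t ht => ?_)
    rw [← Real.dist_eq]
    refine (hv.dist_le_mul t z).trans ?_
    gcongr
    rw [Metric.mem_ball, dist_eq_norm] at ht
    rw [dist_eq_norm]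
    have : t - z = (t - (z - d)) - d := by abel
    rw [this]
    refine (norm_sub_le _ _).trans ?_
    linarith
  · intro x e c ε hε h
    have hc2 : Continuous (fun t => v (t + e)) := hv.continuous.comp (continuous_id.add continuous_const)
    have e1 : g (x + e - d) = convolution (φ.normed volume) (fun t => v (t + e))
      (ContinuousLinearMap.lsmul ℝ ℝ) volume (x - d) := by
      simp only [g, convolution]
      congr 1; ext t; congr 2; abel
    have i1 : ConvolutionExistsAt (φ.normed volume) (fun t => v (t + e)) (x - d)
        (ContinuousLinearMap.lsmul ℝ ℝ) volume :=
      hcs.convolutionExists_left _ hcf (hc2.locallyIntegrable) _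
    have i2 : ConvolutionExistsAt (φ.normed volume) v (x - d)
        (ContinuousLinearMap.lsmul ℝ ℝ) volume :=
      hcs.convolutionExists_left _ hcf hli _
    have e2 : g (x + e - d) - g (x - d) = convolution (φ.normed volume) (fun t => v (t + e) - v t)
      (ContinuousLinearMap.lsmul ℝ ℝ) volume (x - d) := by
      rw [e1]
      simp only [g, convolution]
      rw [← integral_sub i1 i2]
      congr 1; ext t; simp; ring
    beta_reduce
    rw [e2]
    refine key _ (hc2.sub hv.continuous) (x - d) c ε hε (fun t ht => h t ?_)
    rw [Metric.mem_ball, dist_eq_norm] at ht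
    rw [dist_eq_norm]
    have : t - x = (t - (x - d)) - d := by abel
    rw [this]
    refine lt_of_le_of_lt (norm_sub_le _ _) ?_
    linarith

lemma norm_e1 : ‖((1, 0) : ℝ × ℝ)‖ = 1 := by simp [Prod.norm_def]
lemma norm_e2 : ‖((0, 1) : ℝ × ℝ)‖ = 1 := by simp [Prod.norm_def]

lemma relax (T : Set (ℝ × ℝ)) (hTm : MeasurableSet T) (hTb : Bornology.IsBounded T) (Λ : ℝ)
    (H : ∀ v : ℝ × ℝ → ℝ, ContDiff ℝ 1 v → (∀ z, z.2 ≤ 0 → v z = 0) →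
      Λ * ∫ z in T, v z ^ 2 ≤ ∫ z in T, ((fderiv ℝ v z (1, 0))^2 + (fderiv ℝ v z (0, 1))^2))
    (v : ℝ × ℝ → ℝ) (K : NNReal) (hv : LipschitzWith K v) (hv0 : ∀ z, z.2 ≤ 0 → v z = 0)
    (hd : ∀ᵐ z : ℝ × ℝ, HasStrictFDerivAt v (fderiv ℝ v z) z) :
    Λ * ∫ z in T, v z ^ 2 ≤ ∫ z in T, ((fderiv ℝ v z (1, 0))^2 + (fderiv ℝ v z (0, 1))^2) := by
  have hpos : ∀ n : ℕ, (0:ℝ) < 1 / ((n:ℝ) + 1) := fun n => by positivity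
  have hlim : Tendsto (fun n : ℕ => 1 / ((n:ℝ) + 1)) atTop (𝓝 0) := tendsto_one_div_add_atTop_nhds_zero_nat
  choose u hu1 hu2 hu3 hu4 using fun n : ℕ => moll v K hv hv0 (1 / ((n:ℝ) + 1)) (hpos n)
  have hul : ∀ n x y, |u n x - u n y| ≤ K * ‖x - y‖ := by
    intro n x y
    have := hu4 n y (x - y) 0 (K * ‖x - y‖) (by positivity) (fun t _ => by
      have := hv.dist_le_mul (t + (x - y)) t
      simpa [Real.dist_eq, dist_eq_norm] using this)
    simpa using this
  have hfd : ∀ n x, ‖fderiv ℝ (u n) x‖ ≤ K := by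
    intro n x
    refine HasFDerivAt.le_of_lip' ((hu1 n).differentiable one_ne_zero x).hasFDerivAt (K.2) ?_
    exact Eventually.of_forall fun y => hul n y x
  have hfc : ∀ n, Continuous (fderiv ℝ (u n)) := fun n => (hu1 n).continuous_fderiv one_ne_zero
  obtain ⟨R, hR⟩ := hTb.exists_norm_le
  have hTfin : volume T ≠ ⊤ := hTb.measure_lt_top.ne
  have hub : ∀ n, ∀ z ∈ T, |u n z| ≤ K * R := by
    intro n z hz
    have := hul n z (z.1, 0)
    rw [hu2 n (z.1, 0) le_rfl, sub_zero] at this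
    refine this.trans ?_
    gcongr
    refine le_trans ?_ (hR z hz)
    have : z - (z.1, 0) = (0, z.2) := by ext <;> simp
    rw [this]; simp [Prod.norm_def]
  have hcv : ∀ z, Tendsto (fun n => u n z) atTop (𝓝 (v z)) := by
    intro z
    rw [tendsto_iff_norm_sub_tendsto_zero]
    refine squeeze_zero (fun _ => norm_nonneg _) (fun n => hu3 n z) ?_
    have := (hlim.const_mul 2).const_mul (K:ℝ)
    simpa using this
  have hcd : ∀ z, HasStrictFDerivAt v (fderiv ℝ v z) z →
      Tendsto (fun n => fderiv ℝ (u n) z) atTop (𝓝 (fderiv ℝ v z)) := by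
    intro z hz
    rw [Metric.tendsto_atTop]
    intro ε hε
    have h1 := hz.isLittleO.def (half_pos hε)
    rw [Metric.eventually_nhds_iff] at h1
    obtain ⟨r, hr, h1⟩ := h1
    have h2 : ∀ᶠ n : ℕ in atTop, 1 / ((n:ℝ) + 1) < r / 6 := hlim.eventually_lt_const (by positivity)
    obtain ⟨n0, hn0⟩ := h2.exists_forall_of_atTop
    refine ⟨n0, fun n hn => ?_⟩
    have hδ := hn0 n hn
    rw [dist_eq_norm]
    refine lt_of_le_of_lt ?_ (half_lt_self hε)
    have hD : HasFDerivAt (fun y => u n y - fderiv ℝ v z y) (fderiv ℝ (u n) z - fderiv ℝ v z) z :=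
      ((hu1 n).differentiable one_ne_zero z).hasFDerivAt.sub (fderiv ℝ v z).hasFDerivAt
    refine HasFDerivAt.le_of_lip' hD (half_pos hε).le ?_
    filter_upwards [Metric.ball_mem_nhds z (half_pos hr)] with y hy
    have h3 := hu4 n z (y - z) (fderiv ℝ v z (y - z)) (ε / 2 * ‖y - z‖) (by positivity) (fun t ht => by
      have hd1 : dist (t + (y - z)) z < r := by
        rw [Metric.mem_ball, dist_eq_norm] at hy
        rw [dist_eq_norm] at ht ⊢
        have : t + (y - z) - z = (t - z) + (y - z) := by abel
        rw [this]
        refine lt_of_le_of_lt (norm_add_le _ _) ?_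
        linarith
      have hd2 : dist t z < r := by linarith
      have := @h1 (t + (y - z), t) (by rw [Prod.dist_eq]; exact max_lt hd1 hd2)
      simpa using this)
    have e : y - z + z = y := by abel
    rw [add_sub_cancel] at h3
    rw [map_sub] at h3
    rw [Real.norm_eq_abs]
    convert h3 using 2
    ring
  have L1 : Tendsto (fun n => ∫ z in T, u n z ^ 2) atTop (𝓝 (∫ z in T, v z ^ 2)) := by
    apply tendsto_integral_of_dominated_convergence (fun _ => (K * R)^2)
    · intro n; exact ((hu1 n).continuous.pow 2).aestronglyMeasurable
    · exact integrableOn_const hTfin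
    · intro n
      filter_upwards [ae_restrict_mem hTm] with z hz
      rw [norm_pow]
      exact pow_le_pow_left₀ (norm_nonneg _) (hub n z hz) 2
    · exact Eventually.of_forall fun z => (hcv z).pow 2
  have L2 : Tendsto (fun n => ∫ z in T, ((fderiv ℝ (u n) z (1, 0))^2 + (fderiv ℝ (u n) z (0, 1))^2)) atTop
      (𝓝 (∫ z in T, ((fderiv ℝ v z (1, 0))^2 + (fderiv ℝ v z (0, 1))^2))) := by
    apply tendsto_integral_of_dominated_convergence (fun _ => (K:ℝ)^2 + (K:ℝ)^2)
    · intro n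
      exact ((((hfc n).clm_apply continuous_const).pow 2).add
        (((hfc n).clm_apply continuous_const).pow 2)).aestronglyMeasurable
    · exact integrableOn_const hTfin
    · intro n
      refine Eventually.of_forall fun z => ?_
      refine (norm_add_le _ _).trans ?_
      rw [norm_pow, norm_pow]
      have a1 := (fderiv ℝ (u n) z).le_of_opNorm_le (hfd n z) (1, 0)
      have a2 := (fderiv ℝ (u n) z).le_of_opNorm_le (hfd n z) (0, 1)
      rw [norm_e1, mul_one] at a1
      rw [norm_e2, mul_one] at a2
      gcongr
    · filter_upwards [ae_restrict_of_ae hd] with z hz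
      have := hcd z hz
      have ev : ∀ e : ℝ × ℝ, Tendsto (fun n => fderiv ℝ (u n) z e) atTop (𝓝 (fderiv ℝ v z e)) := by
        intro e
        exact ((ContinuousLinearMap.apply ℝ ℝ e).continuous.tendsto _).comp this
      exact ((ev _).pow 2).add ((ev _).pow 2)
  exact le_of_tendsto_of_tendsto (L1.const_mul Λ) L2 (Eventually.of_forall fun n =>
    H (u n) (hu1 n) (hu2 n))

def tent (x : ℝ) : ℝ := max 0 (1 - |x|)

lemma tent_nonneg (x : ℝ) : 0 ≤ tent x := le_max_left _ _
lemma tent_le_one (x : ℝ) : tent x ≤ 1 := max_le (by norm_num) (by linarith [abs_nonneg x])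

lemma tent_lip (x y : ℝ) : |tent x - tent y| ≤ |x - y| := by
  unfold tent
  have h1 := abs_max_sub_max_le_max (0:ℝ) (1 - |x|) 0 (1 - |y|)
  refine h1.trans ?_
  have h2 : |(1 - |x|) - (1 - |y|)| ≤ |x - y| := by
    have : (1 - |x|) - (1 - |y|) = |y| - |x| := by ring
    rw [this, abs_sub_comm x y]
    exact abs_abs_sub_abs_le y x
  simp only [sub_self, abs_zero]
  exact max_le (abs_nonneg _) h2

lemma tent_a (s : ℝ) (h0 : 0 ≤ s) (h1 : s ≤ 1) : tent s = 1 - s := by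
  unfold tent; rw [abs_of_nonneg h0, max_eq_right]; linarith
lemma tent_b (s : ℝ) (h0 : -1 ≤ s) (h1 : s ≤ 0) : tent s = 1 + s := by
  unfold tent; rw [abs_of_nonpos h1, max_eq_right] <;> linarith
lemma tent_c (s : ℝ) (h : 1 ≤ |s|) : tent s = 0 := by
  unfold tent; rw [max_eq_left]; linarith

lemma tent_cd (x : ℝ) (h0 : x ≠ 0) (h1 : x ≠ 1) (h2 : x ≠ -1) : ContDiffAt ℝ 1 tent x := by
  rcases lt_or_gt_of_ne h0 with h | h
  · rcases lt_or_gt_of_ne h2 with h' | h'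
    · refine (contDiffAt_const (c := (0:ℝ))).congr_of_eventuallyEq ?_
      filter_upwards [eventually_lt_nhds h'] with y hy
      exact tent_c y (by rw [abs_of_neg (by linarith)]; linarith)
    · have : ContDiffAt ℝ 1 (fun y : ℝ => 1 + y) x := by fun_prop
      refine this.congr_of_eventuallyEq ?_
      filter_upwards [eventually_lt_nhds h, eventually_gt_nhds h'] with y hy hy'
      exact tent_b y hy'.le hy.le
  · rcases lt_or_gt_of_ne h1 with h' | h'
    · have : ContDiffAt ℝ 1 (fun y : ℝ => 1 - y) x := by fun_prop
      refine this.congr_of_eventuallyEq ?_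
      filter_upwards [eventually_lt_nhds h', eventually_gt_nhds h] with y hy hy'
      exact tent_a y hy'.le hy.le
    · refine (contDiffAt_const (c := (0:ℝ))).congr_of_eventuallyEq ?_
      filter_upwards [eventually_gt_nhds h'] with y hy
      exact tent_c y (by rw [abs_of_pos (by linarith)]; linarith)

/-- one-dimensional interpolation -/
lemma tent_sum (M : ℕ) (c : ℕ → ℝ) (i : ℕ) (hi : i + 1 < M) (X : ℝ) (h0 : i ≤ X) (h1 : X ≤ i + 1) :
    ∑ k ∈ Finset.range M, c k * tent (X - k) = (1 - (X - i)) * c i + (X - i) * c (i+1) := by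
  have hs : ∑ k ∈ ({i, i+1} : Finset ℕ), c k * tent (X - k) = ∑ k ∈ Finset.range M, c k * tent (X - k) := by
    apply Finset.sum_subset
    · intro k hk
      simp only [Finset.mem_insert, Finset.mem_singleton] at hk
      simp only [Finset.mem_range]; omega
    · intro k _ hk
      simp only [Finset.mem_insert, Finset.mem_singleton, not_or] at hk
      rw [tent_c, mul_zero]
      rcases lt_or_gt_of_ne hk.1 with h | h
      · have : (k:ℝ) + 1 ≤ i := by exact_mod_cast h
        rw [abs_of_nonneg] <;> linarith
      · have h' : i + 2 ≤ k := by omega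
        have : (i:ℝ) + 2 ≤ k := by exact_mod_cast h'
        rw [abs_of_nonpos] <;> linarith
  rw [← hs, Finset.sum_pair (by omega), tent_a _ (by linarith) (by linarith)]
  push_cast
  rw [tent_b (X - (i + 1)) (by linarith) (by linarith)]
  ring

def Qf (v : ℕ → ℕ → ℝ) (i j : ℕ) (X Y : ℝ) : ℝ :=
  (1 - (X - i)) * ((1 - (Y - j)) * v i j + (Y - j) * v i (j+1)) +
  (X - i) * ((1 - (Y - j)) * v (i+1) j + (Y - j) * v (i+1) (j+1))

def Ph (M : ℕ) (v : ℕ → ℕ → ℝ) (X Y : ℝ) : ℝ :=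
  ∑ i ∈ Finset.range M, ∑ j ∈ Finset.range M, v i j * (tent (X - i) * tent (Y - j))

lemma Ph_loc (M : ℕ) (v : ℕ → ℕ → ℝ) (i j : ℕ) (hi : i + 1 < M) (hj : j + 1 < M) (X Y : ℝ)
    (h0 : i ≤ X) (h1 : X ≤ i + 1) (h2 : j ≤ Y) (h3 : Y ≤ j + 1) : Ph M v X Y = Qf v i j X Y := by
  unfold Ph Qf
  have : ∀ k, ∑ l ∈ Finset.range M, v k l * (tent (X - k) * tent (Y - l))
     = ((1 - (Y - j)) * v k j + (Y - j) * v k (j+1)) * tent (X - k) := by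
    intro k
    rw [← tent_sum M (v k) j hj Y h2 h3, Finset.sum_mul]
    refine Finset.sum_congr rfl fun l _ => by ring
  simp only [this]
  rw [tent_sum M (fun k => (1 - (Y - j)) * v k j + (Y - j) * v k (j+1)) i hi X h0 h1]

def Lip (f : ℝ × ℝ → ℝ) : Prop := ∃ K : NNReal, LipschitzWith K f

lemma Lip.add {f g : ℝ × ℝ → ℝ} (hf : Lip f) (hg : Lip g) : Lip (fun z => f z + g z) := by
  obtain ⟨K, hK⟩ := hf; obtain ⟨L, hL⟩ := hg
  exact ⟨_, hK.add hL⟩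
lemma Lip.sub {f g : ℝ × ℝ → ℝ} (hf : Lip f) (hg : Lip g) : Lip (fun z => f z - g z) := by
  obtain ⟨K, hK⟩ := hf; obtain ⟨L, hL⟩ := hg
  exact ⟨_, hK.sub hL⟩
lemma Lip.cmul {f : ℝ × ℝ → ℝ} (c : ℝ) (hf : Lip f) : Lip (fun z => c * f z) := by
  obtain ⟨K, hK⟩ := hf
  refine ⟨‖c‖₊ * K, LipschitzWith.of_dist_le_mul fun x y => ?_⟩
  have := hK.dist_le_mul x y
  rw [Real.dist_eq] at this ⊢
  rw [← mul_sub, abs_mul]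
  push_cast
  rw [mul_assoc]
  exact mul_le_mul_of_nonneg_left this (abs_nonneg c)
lemma Lip.sum {ι : Type*} (s : Finset ι) (f : ι → ℝ × ℝ → ℝ) (hf : ∀ i, Lip (f i)) :
    Lip (fun z => ∑ i ∈ s, f i z) := by
  classical
  induction s using Finset.induction_on with
  | empty => exact ⟨0, by simp⟩
  | insert i s hi ih =>
    simp only [Finset.sum_insert hi]
    exact (hf i).add ih

lemma tent2_lip (g1 g2 : ℝ × ℝ → ℝ) (h1 : Lip g1) (h2 : Lip g2) (i j : ℝ) :
    Lip (fun z => tent (g1 z - i) * tent (g2 z - j)) := by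
  obtain ⟨K, hK⟩ := h1; obtain ⟨L, hL⟩ := h2
  refine ⟨K + L, LipschitzWith.of_dist_le_mul fun x y => ?_⟩
  have a1 := hK.dist_le_mul x y
  have a2 := hL.dist_le_mul x y
  rw [Real.dist_eq] at a1 a2 ⊢
  have b1 := tent_lip (g1 x - i) (g1 y - i)
  have b2 := tent_lip (g2 x - j) (g2 y - j)
  rw [sub_sub_sub_cancel_right] at b1 b2
  have e : tent (g1 x - i) * tent (g2 x - j) - tent (g1 y - i) * tent (g2 y - j)
    = (tent (g1 x - i) - tent (g1 y - i)) * tent (g2 x - j) + tent (g1 y - i) * (tent (g2 x - j) - tent (g2 y - j)) := by ring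
  rw [e]
  refine (abs_add_le _ _).trans ?_
  rw [abs_mul, abs_mul, abs_of_nonneg (tent_nonneg _), abs_of_nonneg (tent_nonneg _)]
  push_cast
  have c1 := tent_le_one (g2 x - j)
  have c2 := tent_le_one (g1 y - i)
  have d1 := mul_le_mul_of_nonneg_left c1 (abs_nonneg (tent (g1 x - i) - tent (g1 y - i)))
  have d2 := mul_le_mul_of_nonneg_right c2 (abs_nonneg (tent (g2 x - j) - tent (g2 y - j)))
  rw [add_mul]
  linarith

lemma Ph_lip (M : ℕ) (v : ℕ → ℕ → ℝ) (g1 g2 : ℝ × ℝ → ℝ) (h1 : Lip g1) (h2 : Lip g2) :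
    Lip (fun z => Ph M v (g1 z) (g2 z)) := by
  unfold Ph
  exact Lip.sum _ _ fun i => Lip.sum _ _ fun j => (tent2_lip g1 g2 h1 h2 i j).cmul _

lemma Ph_cd (M : ℕ) (v : ℕ → ℕ → ℝ) (g1 g2 : ℝ × ℝ → ℝ) (z : ℝ × ℝ) (h1 : ContDiffAt ℝ 1 g1 z)
    (h2 : ContDiffAt ℝ 1 g2 z) (n1 : ∀ k : ℤ, g1 z ≠ k) (n2 : ∀ k : ℤ, g2 z ≠ k) :
    ContDiffAt ℝ 1 (fun z => Ph M v (g1 z) (g2 z)) z := by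
  have key : ∀ (g : ℝ × ℝ → ℝ) (hg : ContDiffAt ℝ 1 g z) (n : ∀ k : ℤ, g z ≠ k) (i : ℕ),
      ContDiffAt ℝ 1 (fun z => tent (g z - i)) z := by
    intro g hg n i
    refine ContDiffAt.comp (g := tent) (f := fun z => g z - (i:ℝ)) z (tent_cd (g z - i) ?_ ?_ ?_) (hg.sub contDiffAt_const)
    · intro h; exact n i (by push_cast; linarith)
    · intro h; exact n (i+1) (by push_cast; linarith)
    · intro h; exact n (i-1) (by push_cast; linarith)
  unfold Ph
  exact ContDiffAt.sum fun i _ => ContDiffAt.sum fun j _ =>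
    contDiffAt_const.mul ((key g1 h1 n1 i).mul (key g2 h2 n2 j))

lemma Ph_zero (M : ℕ) (v : ℕ → ℕ → ℝ) (h0 : ∀ i, v i 0 = 0) (X Y : ℝ) (hY : Y ≤ 0) : Ph M v X Y = 0 := by
  unfold Ph
  refine Finset.sum_eq_zero fun i _ => Finset.sum_eq_zero fun j _ => ?_
  rcases Nat.eq_zero_or_pos j with rfl | hj
  · rw [h0, zero_mul]
  · have : (1:ℝ) ≤ j := by exact_mod_cast hj
    rw [tent_c (Y - j), mul_zero, mul_zero]
    rw [abs_of_nonpos] <;> linarith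

lemma int1 (b : ℝ) (hb : 0 < b) (j : ℕ) (c0 c1 : ℝ) :
    ∫ y in Set.Ico (j * b) ((j+1) * b), (c0 * (1 - (y/b - j)) + c1 * (y/b - j)) = b * ((c0 + c1) / 2) := by
  rw [integral_Ico_eq_integral_Ioc, ← intervalIntegral.integral_of_le (by nlinarith)]
  have e : ∀ y : ℝ, (c0 * (1 - (y/b - j)) + c1 * (y/b - j)) = (c0 * (1 + j) - c1 * j) + ((c1 - c0) / b) * y := by
    intro y; field_simp; ring
  simp only [e]
  rw [intervalIntegral.integral_add (by simp) (by apply Continuous.intervalIntegrable; fun_prop),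
    intervalIntegral.integral_const, intervalIntegral.integral_const_mul, integral_id]
  simp only [smul_eq_mul]
  field_simp
  ring

lemma int2y (a b : ℝ) (ha : 0 < a) (hb : 0 < b) (i j : ℕ) (c0 c1 : ℝ) :
    ∫ z in cell a b i j, (c0 * (1 - (z.2/b - j)) + c1 * (z.2/b - j)) = a * b * ((c0 + c1) / 2) := by
  unfold cell
  have := setIntegral_prod_mul (μ := (volume : Measure ℝ)) (ν := (volume : Measure ℝ))
    (fun _ : ℝ => (1:ℝ)) (fun y : ℝ => (c0 * (1 - (y/b - j)) + c1 * (y/b - j)))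
    (Set.Ico (i * a) ((i+1) * a)) (Set.Ico (j * b) ((j+1) * b))
  rw [int1 b hb] at this
  simp only [one_mul] at this
  rw [Measure.volume_eq_prod, this]
  simp
  rw [max_eq_left (by nlinarith)]
  ring

lemma int2x (a b : ℝ) (ha : 0 < a) (hb : 0 < b) (i j : ℕ) (c0 c1 : ℝ) :
    ∫ z in cell a b i j, (c0 * (1 - (z.1/a - i)) + c1 * (z.1/a - i)) = a * b * ((c0 + c1) / 2) := by
  unfold cell
  have := setIntegral_prod_mul (μ := (volume : Measure ℝ)) (ν := (volume : Measure ℝ))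
    (fun y : ℝ => (c0 * (1 - (y/a - i)) + c1 * (y/a - i))) (fun _ : ℝ => (1:ℝ)) 
    (Set.Ico (i * a) ((i+1) * a)) (Set.Ico (j * b) ((j+1) * b))
  rw [int1 a ha] at this
  simp only [mul_one] at this
  rw [Measure.volume_eq_prod, this]
  simp
  rw [max_eq_left (by nlinarith)]
  ring

lemma cell_sub (a b : ℝ) (i j : ℕ) :
    cell a b i j ⊆ Set.Icc (i * a) ((i + 1) * a) ×ˢ Set.Icc (j * b) ((j + 1) * b) :=
  Set.prod_mono Set.Ico_subset_Icc_self Set.Ico_subset_Icc_self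

lemma cell_int (a b : ℝ) (i j : ℕ) (g : ℝ × ℝ → ℝ) (hg : Continuous g) :
    IntegrableOn g (cell a b i j) :=
  (hg.continuousOn.integrableOn_compact (isCompact_Icc.prod isCompact_Icc)).mono_set (cell_sub a b i j)

lemma step_ind (a b : ℝ) (N : ℕ) (G : ℕ → ℕ → ℝ × ℝ → ℝ) (z : ℝ × ℝ) :
    ∑ i ∈ Finset.range N, ∑ j ∈ Finset.range (N - i), (cell a b i j).indicator (G i j) z
      = stepf a b N (fun i j => G i j z) z := by
  classical
  unfold stepf
  simp only [Set.indicator_apply]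

lemma step_int (a b : ℝ) (N : ℕ) (G : ℕ → ℕ → ℝ × ℝ → ℝ) (hG : ∀ i j, Continuous (G i j)) :
    Integrable (fun z => stepf a b N (fun i j => G i j z) z) ∧
    ∫ z, stepf a b N (fun i j => G i j z) z
      = ∑ i ∈ Finset.range N, ∑ j ∈ Finset.range (N - i), ∫ z in cell a b i j, G i j z := by
  have hint : ∀ i j, Integrable ((cell a b i j).indicator (G i j)) := by
    intro i j
    rw [integrable_indicator_iff (cell_meas _ _ _ _)]
    exact cell_int a b i j _ (hG i j)
  simp only [← step_ind]
  refine ⟨integrable_finsetSum _ (fun i _ => integrable_finsetSum _ (fun j _ => hint i j)), ?_⟩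
  rw [integral_finsetSum _ (fun i _ => integrable_finsetSum _ (fun j _ => hint i j))]
  refine Finset.sum_congr rfl fun i _ => ?_
  rw [integral_finsetSum _ (fun j _ => hint i j)]
  refine Finset.sum_congr rfl fun j _ => ?_
  rw [integral_indicator (cell_meas _ _ _ _)]

lemma ae_off (a b : ℝ) : ∀ᵐ z : ℝ × ℝ, (∀ i : ℤ, z.1 ≠ i * a) ∧ (∀ j : ℤ, z.2 ≠ j * b) := by
  have h1 : ∀ᵐ z : ℝ × ℝ, ∀ i : ℤ, z.1 ≠ i * a := ae_all_iff.mpr fun i => ae_fst_ne _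
  have h2 : ∀ᵐ z : ℝ × ℝ, ∀ i : ℤ, z.2 ≠ i * b := ae_all_iff.mpr fun i => ae_snd_ne _
  exact h1.and h2

lemma TH_floor (q h : ℝ) (hq : 0 < q) (hh : 0 < h) (K : ℕ) (hK : 0 < K) (z : ℝ × ℝ) (hz : z ∈ TH q h) :
    (0 ≤ z.1 ∧ 0 ≤ z.2) ∧ ⌊z.1 / (q/K)⌋₊ + ⌊z.2 / (h/K)⌋₊ < K := by
  obtain ⟨z1, z2, z3⟩ := hz
  refine ⟨⟨z1.le, z2.le⟩, ?_⟩
  have hK' : (0:ℝ) < K := by exact_mod_cast hK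
  have f1 := Nat.floor_le (a := z.1 / (q/K)) (by positivity)
  have f2 := Nat.floor_le (a := z.2 / (h/K)) (by positivity)
  have e : z.1 / (q/K) + z.2 / (h/K) = (z.1/q + z.2/h) * K := by field_simp
  have : ((⌊z.1 / (q/K)⌋₊ + ⌊z.2 / (h/K)⌋₊ : ℕ) : ℝ) < K := by
    push_cast
    nlinarith
  exact_mod_cast this

lemma cells_le (q h : ℝ) (hq : 0 < q) (hh : 0 < h) (K : ℕ) (hK : 0 < K) (F : ℝ × ℝ → ℝ)
    (G : ℕ → ℕ → ℝ × ℝ → ℝ) (hG : ∀ i j, Continuous (G i j)) (hF : ∀ z, 0 ≤ F z)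
    (hFG : ∀ᵐ z : ℝ × ℝ, ∀ i j, i + j < K → z ∈ cell (q/K) (h/K) i j → F z ≤ G i j z) :
    ∫ z in TH q h, F z ≤ ∑ i ∈ Finset.range K, ∑ j ∈ Finset.range (K - i),
      ∫ z in cell (q/K) (h/K) i j, G i j z := by
  have hK' : (0:ℝ) < K := by exact_mod_cast hK
  have ha : 0 < q / K := by positivity
  have hb : 0 < h / K := by positivity
  obtain ⟨s1, s2⟩ := step_int (q/K) (h/K) K G hG
  rw [← s2, ← integral_indicator (TH_open q h).measurableSet]
  refine integral_mono_of_nonneg (Eventually.of_forall fun z => Set.indicator_nonneg (fun z _ => hF z) z) s1 ?_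
  filter_upwards [hFG] with z hz
  rw [stepf_apply _ _ ha hb]
  by_cases hT : z ∈ TH q h
  · have h1 := TH_floor q h hq hh K hK z hT
    rw [Set.indicator_of_mem hT, if_pos h1]
    exact hz _ _ h1.2 ((mem_cell _ _ ha hb _ _ z).mpr ⟨h1.1, rfl, rfl⟩)
  · rw [Set.indicator_of_notMem hT]
    split_ifs with hc
    · exact (hF z).trans (hz _ _ hc.2 ((mem_cell _ _ ha hb _ _ z).mpr ⟨hc.1, rfl, rfl⟩))
    · exact le_rfl

lemma TH_bdd (q h : ℝ) (hq : 0 < q) (hh : 0 < h) : TH q h ⊆ Set.Icc 0 q ×ˢ Set.Icc 0 h := by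
  rintro z ⟨z1, z2, z3⟩
  have h1 : 0 < z.1 / q := by positivity
  have h2 : 0 < z.2 / h := by positivity
  refine ⟨⟨z1.le, ?_⟩, z2.le, ?_⟩
  · exact ((div_lt_one hq).mp (by linarith)).le
  · exact ((div_lt_one hh).mp (by linarith)).le

lemma TH_int (q h : ℝ) (hq : 0 < q) (hh : 0 < h) (g : ℝ × ℝ → ℝ) (hg : Continuous g) :
    IntegrableOn g (TH q h) :=
  (hg.continuousOn.integrableOn_compact (isCompact_Icc.prod isCompact_Icc)).mono_set (TH_bdd q h hq hh)

lemma cells_ge (q h : ℝ) (hq : 0 < q) (hh : 0 < h) (K : ℕ) (hK : 0 < K) (F : ℝ × ℝ → ℝ)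
    (hF : ∀ z, 0 ≤ F z) (hc : Continuous F) :
    ∑ i ∈ Finset.range (K-1), ∑ j ∈ Finset.range (K - 1 - i),
      ∫ z in cell (q/K) (h/K) i j, F z ≤ ∫ z in TH q h, F z := by
  have hK' : (0:ℝ) < K := by exact_mod_cast hK
  have ha : 0 < q / K := by positivity
  have hb : 0 < h / K := by positivity
  obtain ⟨s1, s2⟩ := step_int (q/K) (h/K) (K-1) (fun _ _ => F) (fun _ _ => hc)
  rw [← s2, ← integral_indicator (TH_open q h).measurableSet]
  refine integral_mono_ae s1 ?_ ?_
  · rw [integrable_indicator_iff (TH_open q h).measurableSet]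
    exact TH_int q h hq hh F hc
  · filter_upwards [ae_fst_ne 0, ae_snd_ne 0] with z n1 n2
    rw [stepf_apply _ _ ha hb]
    split_ifs with hcc
    · obtain ⟨⟨z1, z2⟩, hcc⟩ := hcc
      rw [Set.indicator_of_mem]
      refine ⟨lt_of_le_of_ne z1 n1.symm, lt_of_le_of_ne z2 n2.symm, ?_⟩
      have f1 := Nat.lt_floor_add_one (z.1 / (q/K))
      have f2 := Nat.lt_floor_add_one (z.2 / (h/K))
      have e : z.1 / (q/K) + z.2 / (h/K) = (z.1/q + z.2/h) * K := by field_simp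
      have h3 : ⌊z.1 / (q/K)⌋₊ + ⌊z.2 / (h/K)⌋₊ + 2 ≤ K := by omega
      have h4 : (⌊z.1 / (q/K)⌋₊ : ℝ) + ⌊z.2 / (h/K)⌋₊ + 2 ≤ K := by exact_mod_cast h3
      have h5 : (z.1/q + z.2/h) * K < 1 * K := by rw [← e]; linarith
      exact lt_of_mul_lt_mul_right h5 hK'.le
    · exact Set.indicator_nonneg (fun z _ => hF z) z

lemma bil_fd (α β γ κ : ℝ) (z : ℝ × ℝ) :
    fderiv ℝ (fun z : ℝ × ℝ => α + β * z.1 + γ * z.2 + κ * (z.1 * z.2)) z (1, 0) = β + κ * z.2 ∧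
    fderiv ℝ (fun z : ℝ × ℝ => α + β * z.1 + γ * z.2 + κ * (z.1 * z.2)) z (0, 1) = γ + κ * z.1 := by
  have h1 : HasFDerivAt (fun z : ℝ × ℝ => z.1) (ContinuousLinearMap.fst ℝ ℝ ℝ) z := hasFDerivAt_fst
  have h2 : HasFDerivAt (fun z : ℝ × ℝ => z.2) (ContinuousLinearMap.snd ℝ ℝ ℝ) z := hasFDerivAt_snd
  have h := (((hasFDerivAt_const α z).add (h1.const_mul β)).add (h2.const_mul γ)).add ((h1.mul h2).const_mul κ)
  have h' : HasFDerivAt (fun z : ℝ × ℝ => α + β * z.1 + γ * z.2 + κ * (z.1 * z.2)) _ z := h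
  rw [h'.fderiv]
  constructor <;> simp

lemma Qf_fd (v : ℕ → ℕ → ℝ) (i j : ℕ) (a b : ℝ) (ha : 0 < a) (hb : 0 < b) (z : ℝ × ℝ) :
    fderiv ℝ (fun z : ℝ × ℝ => Qf v i j (z.1/a) (z.2/b)) z (1, 0) =
      ((1 - (z.2/b - j)) * (v (i+1) j - v i j) + (z.2/b - j) * (v (i+1) (j+1) - v i (j+1))) / a ∧
    fderiv ℝ (fun z : ℝ × ℝ => Qf v i j (z.1/a) (z.2/b)) z (0, 1) =
      ((1 - (z.1/a - i)) * (v i (j+1) - v i j) + (z.1/a - i) * (v (i+1) (j+1) - v (i+1) j)) / b := by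
  have e : (fun z : ℝ × ℝ => Qf v i j (z.1/a) (z.2/b)) = (fun z : ℝ × ℝ =>
     Qf v i j 0 0 + ((1 + j) * (v (i+1) j - v i j) - j * (v (i+1) (j+1) - v i (j+1))) / a * z.1
      + ((1 + i) * (v i (j+1) - v i j) - i * (v (i+1) (j+1) - v (i+1) j)) / b * z.2
      + (v (i+1) (j+1) - v i (j+1) - v (i+1) j + v i j) / (a * b) * (z.1 * z.2)) := by
    ext z; unfold Qf; field_simp; ring
  rw [e]
  obtain ⟨h1, h2⟩ := bil_fd (Qf v i j 0 0) (((1 + j) * (v (i+1) j - v i j) - j * (v (i+1) (j+1) - v i (j+1))) / a)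
    (((1 + i) * (v i (j+1) - v i j) - i * (v (i+1) (j+1) - v (i+1) j)) / b)
    ((v (i+1) (j+1) - v i (j+1) - v (i+1) j + v i j) / (a * b)) z
  rw [h1, h2]
  constructor <;> (field_simp; ring)

lemma conv_sq (t x y : ℝ) (h0 : 0 ≤ t) (h1 : t ≤ 1) :
    ((1 - t) * x + t * y)^2 ≤ x^2 * (1 - t) + y^2 * t := by
  nlinarith [mul_nonneg (mul_nonneg h0 (sub_nonneg.mpr h1)) (sq_nonneg (x - y))]

/-- `f` is the bilinear interpolant of `v` on the cells `i + j < K`. -/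
def Interp (q h : ℝ) (K : ℕ) (v : ℕ → ℕ → ℝ) (f : ℝ × ℝ → ℝ) : Prop :=
  ∀ i j, i + j < K → ∀ z ∈ cell (q/K) (h/K) i j, f z = Qf v i j (z.1/(q/K)) (z.2/(h/K))

lemma cell_st (a b : ℝ) (ha : 0 < a) (hb : 0 < b) (i j : ℕ) (z : ℝ × ℝ) (hz : z ∈ cell a b i j) :
    0 ≤ z.1/a - i ∧ z.1/a - i ≤ 1 ∧ 0 ≤ z.2/b - j ∧ z.2/b - j ≤ 1 := by
  obtain ⟨⟨h1, h2⟩, h3, h4⟩ := hz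
  rw [← le_div_iff₀ ha] at h1
  rw [← div_lt_iff₀ ha] at h2
  rw [← le_div_iff₀ hb] at h3
  rw [← div_lt_iff₀ hb] at h4
  refine ⟨?_, ?_, ?_, ?_⟩ <;> linarith

lemma grad_sums (K : ℕ) (v : ℕ → ℕ → ℝ) (h0 : ∀ i, v i 0 = 0) (α β : ℝ) (hα : 0 ≤ α) (hβ : 0 ≤ β) :
    ∑ i ∈ Finset.range K, ∑ j ∈ Finset.range (K - i),
      (α * (((v (i+1) j - v i j)^2 + (v (i+1) (j+1) - v i (j+1))^2)/2) +
       β * (((v i (j+1) - v i j)^2 + (v (i+1) (j+1) - v (i+1) j)^2)/2))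
     ≤ α * HP (K+1) v + β * VP (K+1) v := by
  have hsplit : ∑ i ∈ Finset.range K, ∑ j ∈ Finset.range (K - i),
      (α * (((v (i+1) j - v i j)^2 + (v (i+1) (j+1) - v i (j+1))^2)/2) +
       β * (((v i (j+1) - v i j)^2 + (v (i+1) (j+1) - v (i+1) j)^2)/2))
     = α * (∑ i ∈ Finset.range K, ∑ j ∈ Finset.range (K - i), ((v (i+1) j - v i j)^2 + (v (i+1) (j+1) - v i (j+1))^2)/2)
      + β * (∑ i ∈ Finset.range K, ∑ j ∈ Finset.range (K - i), ((v i (j+1) - v i j)^2 + (v (i+1) (j+1) - v (i+1) j)^2)/2) := by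
    simp only [Finset.mul_sum, ← Finset.sum_add_distrib]
  rw [hsplit]
  refine add_le_add (mul_le_mul_of_nonneg_left ?_ hα) (mul_le_mul_of_nonneg_left ?_ hβ)
  · unfold HP
    rw [Finset.sum_range_succ]
    have e0 : K + 1 - K - 1 = 0 := by omega
    rw [e0, Finset.range_zero, Finset.sum_empty, add_zero]
    refine Finset.sum_le_sum fun i _ => ?_
    have e1 : K + 1 - i - 1 = K - i := by omega
    rw [e1]
    generalize K - i = n
    have hm : ∀ n, ∑ j ∈ Finset.range n, ((v (i+1) j - v i j)^2 + (v (i+1) (j+1) - v i (j+1))^2)/2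
       = ∑ j ∈ Finset.range n, (v (i+1) (j+1) - v i (j+1))^2 - (v (i+1) n - v i n)^2/2 := by
      intro n
      induction n with
      | zero => simp [h0]
      | succ n ih => rw [Finset.sum_range_succ, Finset.sum_range_succ, ih]; ring
    rw [hm]
    nlinarith [sq_nonneg (v (i+1) n - v i n)]
  · unfold VP
    set S : ℕ → ℝ := fun i => ∑ j ∈ Finset.range (K + 1 - i), (v i (j+1) - v i j)^2 with hS
    have hSn : ∀ i, 0 ≤ S i := fun i => Finset.sum_nonneg fun j _ => sq_nonneg _
    have b1 : ∀ i, ∑ j ∈ Finset.range (K - i), ((v i (j+1) - v i j)^2 + (v (i+1) (j+1) - v (i+1) j)^2)/2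
        ≤ (S i + S (i+1))/2 := by
      intro i
      rw [← Finset.sum_div, Finset.sum_add_distrib]
      have c1 : ∑ j ∈ Finset.range (K - i), (v i (j+1) - v i j)^2 ≤ S i := by
        apply Finset.sum_le_sum_of_subset_of_nonneg
        · apply Finset.range_mono; omega
        · intros; positivity
      have c2 : ∑ j ∈ Finset.range (K - i), (v (i+1) (j+1) - v (i+1) j)^2 = S (i+1) := by
        simp only [hS]
        have : K + 1 - (i+1) = K - i := by omega
        rw [this]
      rw [c2]; linarith
    refine (Finset.sum_le_sum fun i _ => b1 i).trans ?_
    change _ ≤ ∑ i ∈ Finset.range (K+1), cw i * S i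
    have hm : ∀ n, ∑ i ∈ Finset.range n, (S i + S (i+1))/2 + S n / 2 = ∑ i ∈ Finset.range (n+1), cw i * S i := by
      intro n
      induction n with
      | zero => simp [cw]; ring
      | succ n ih =>
        rw [Finset.sum_range_succ, Finset.sum_range_succ (fun i => cw i * S i) (n+1), ← ih]
        simp [cw]; ring
    rw [← hm]
    linarith [hSn K]

lemma half_grad (q h : ℝ) (hq : 0 < q) (hh : 0 < h) (K : ℕ) (hK : 0 < K) (v : ℕ → ℕ → ℝ)
    (h0 : ∀ i, v i 0 = 0) (f : ℝ × ℝ → ℝ) (hf : Interp q h K v f) :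
    ∫ z in TH q h, ((fderiv ℝ f z (1, 0))^2 + (fderiv ℝ f z (0, 1))^2)
      ≤ h/q * HP (K+1) v + q/h * VP (K+1) v := by
  have hK' : (0:ℝ) < K := by exact_mod_cast hK
  set a := q / K with ha'
  set b := h / K with hb'
  have ha : 0 < a := by positivity
  have hb : 0 < b := by positivity
  let G1 : ℕ → ℕ → ℝ × ℝ → ℝ := fun i j z =>
    ((v (i+1) j - v i j)^2/a^2) * (1 - (z.2/b - j)) + ((v (i+1) (j+1) - v i (j+1))^2/a^2) * (z.2/b - j)
  let G2 : ℕ → ℕ → ℝ × ℝ → ℝ := fun i j z =>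
    ((v i (j+1) - v i j)^2/b^2) * (1 - (z.1/a - i)) + ((v (i+1) (j+1) - v (i+1) j)^2/b^2) * (z.1/a - i)
  have hG1 : ∀ i j, Continuous (G1 i j) := fun i j => by simp only [G1]; fun_prop
  have hG2 : ∀ i j, Continuous (G2 i j) := fun i j => by simp only [G2]; fun_prop
  have key := cells_le q h hq hh K hK (fun z => (fderiv ℝ f z (1, 0))^2 + (fderiv ℝ f z (0, 1))^2)
    (fun i j z => G1 i j z + G2 i j z) (fun i j => (hG1 i j).add (hG2 i j)) (fun z => by positivity) (by
      filter_upwards [ae_off a b] with z hz i j hij hc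
      have hst := cell_st a b ha hb i j z hc
      have hev : f =ᶠ[𝓝 z] (fun z => Qf v i j (z.1/a) (z.2/b)) := by
        obtain ⟨⟨c1, c2⟩, c3, c4⟩ := hc
        have d1 : i * a < z.1 := lt_of_le_of_ne c1 (Ne.symm (by exact_mod_cast hz.1 i))
        have d3 : j * b < z.2 := lt_of_le_of_ne c3 (Ne.symm (by exact_mod_cast hz.2 j))
        have o : IsOpen (Set.Ioo (i * a) ((i+1) * a) ×ˢ Set.Ioo (j * b) ((j+1) * b)) := isOpen_Ioo.prod isOpen_Ioo
        filter_upwards [o.mem_nhds ⟨⟨d1, c2⟩, d3, c4⟩] with y hy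
        exact hf i j hij y ⟨⟨hy.1.1.le, hy.1.2⟩, hy.2.1.le, hy.2.2⟩
      rw [hev.fderiv_eq]
      obtain ⟨q1, q2⟩ := Qf_fd v i j a b ha hb z
      rw [q1, q2, div_pow _ a 2, div_pow _ b 2]
      refine add_le_add ?_ ?_
      · have := conv_sq (z.2/b - j) (v (i+1) j - v i j) (v (i+1) (j+1) - v i (j+1)) hst.2.2.1 hst.2.2.2
        have := div_le_div_of_nonneg_right this (sq_nonneg a)
        refine this.trans (le_of_eq ?_)
        simp only [G1]; ring
      · have := conv_sq (z.1/a - i) (v i (j+1) - v i j) (v (i+1) (j+1) - v (i+1) j) hst.1 hst.2.1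
        have := div_le_div_of_nonneg_right this (sq_nonneg b)
        refine this.trans (le_of_eq ?_)
        simp only [G2]; ring)
  refine key.trans ?_
  refine le_trans (le_of_eq ?_) (grad_sums K v h0 (h/q) (q/h) (by positivity) (by positivity))
  refine Finset.sum_congr rfl fun i _ => Finset.sum_congr rfl fun j _ => ?_
  rw [integral_add (cell_int _ _ _ _ _ (hG1 i j)) (cell_int _ _ _ _ _ (hG2 i j))]
  simp only [G1, G2]
  rw [int2y a b ha hb, int2x a b ha hb]
  rw [ha', hb']
  field_simp

lemma Qf_dev (v : ℕ → ℕ → ℝ) (i j : ℕ) (X Y : ℝ) (s0 : 0 ≤ X - i) (s1 : X - i ≤ 1) (t0 : 0 ≤ Y - j)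
    (t1 : Y - j ≤ 1) :
    (Qf v i j X Y - v i (j+1))^2 ≤ (v i (j+1) - v i j)^2 + 2 * (v (i+1) (j+1) - v i (j+1))^2
      + 2 * (v (i+1) (j+1) - v (i+1) j)^2 := by
  unfold Qf
  generalize X - i = s at *
  generalize Y - j = t at *
  set e0 := v i (j+1) - v i j with he0
  set d := v (i+1) (j+1) - v i (j+1) with hd
  set e1 := v (i+1) (j+1) - v (i+1) j with he1
  have e : (1 - s) * ((1 - t) * v i j + t * v i (j+1)) + s * ((1 - t) * v (i+1) j + t * v (i+1) (j+1)) - v i (j+1)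
     = (1 - s) * (-((1-t) * e0)) + s * (d - (1-t) * e1) := by rw [he0, hd, he1]; ring
  rw [e]
  refine (conv_sq s _ _ s0 s1).trans ?_
  have a1 : (-((1-t) * e0))^2 ≤ e0^2 := by
    have : (1-t)^2 ≤ 1 := by nlinarith
    nlinarith [sq_nonneg e0]
  have a2 : (d - (1-t) * e1)^2 ≤ 2 * d^2 + 2 * e1^2 := by
    have : (1-t)^2 ≤ 1 := by nlinarith
    nlinarith [sq_nonneg e1, sq_nonneg (d + (1-t)*e1)]
  nlinarith [sq_nonneg e0, sq_nonneg d, sq_nonneg e1, mul_le_mul_of_nonneg_right a1 (sub_nonneg.mpr s1),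
    mul_le_mul_of_nonneg_right a2 s0, mul_nonneg s0 (sq_nonneg e0),
    mul_nonneg (sub_nonneg.mpr s1) (sq_nonneg d), mul_nonneg (sub_nonneg.mpr s1) (sq_nonneg e1)]

lemma tail2 (n : ℕ) (g : ℕ → ℝ) (B : ℝ) (hB : 0 ≤ B) (hg : ∀ j < n, g j ≤ B) :
    ∑ j ∈ Finset.range n, g j ≤ ∑ j ∈ Finset.range (n - 2), g j + 2 * B := by
  rcases n with _ | _ | n
  · simp; exact hB
  · simp; linarith [hg 0 (by omega)]
  · rw [Finset.sum_range_succ, Finset.sum_range_succ]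
    have : n + 1 + 1 - 2 = n := by omega
    rw [this]
    linarith [hg n (by omega), hg (n+1) (by omega)]

lemma tele (x : ℕ → ℝ) (h0 : x 0 = 0) (n j : ℕ) (hj : j < n) :
    (x (j+1))^2 ≤ n * ∑ k ∈ Finset.range n, (x (k+1) - x k)^2 := by
  have e : x (j+1) = ∑ k ∈ Finset.range (j+1), (x (k+1) - x k) := by
    rw [Finset.sum_range_sub, h0, sub_zero]
  rw [e]
  refine (sq_sum_le_card_mul_sum_sq).trans ?_
  rw [Finset.card_range]
  have h1 : ∑ k ∈ Finset.range (j+1), (x (k+1) - x k)^2 ≤ ∑ k ∈ Finset.range n, (x (k+1) - x k)^2 := by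
    apply Finset.sum_le_sum_of_subset_of_nonneg
    · apply Finset.range_mono; omega
    · intros; positivity
  have h2 : ((j+1 : ℕ) : ℝ) ≤ n := by exact_mod_cast hj
  exact mul_le_mul h2 h1 (Finset.sum_nonneg fun _ _ => sq_nonneg _) (by positivity)

lemma half_mass (q h : ℝ) (hq : 0 < q) (hh : 0 < h) (K : ℕ) (hK : 0 < K) (v : ℕ → ℕ → ℝ)
    (h0 : ∀ i, v i 0 = 0) (f : ℝ × ℝ → ℝ) (hf : Interp q h K v f) (hc : Continuous f) :
    q * h / K^2 * MP (K+1) v ≤ (1 + 1/K) * (∫ z in TH q h, f z ^ 2)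
      + (16 * h^2 + 16 * q^2) / K * (h/q * HP (K+1) v + q/h * VP (K+1) v) := by
  have hK' : (0:ℝ) < K := by exact_mod_cast hK
  have hK1 : (1:ℝ) ≤ K := by exact_mod_cast hK
  set a := q / K with ha'
  set b := h / K with hb'
  have ha : 0 < a := by positivity
  have hb : 0 < b := by positivity
  set S : ℕ → ℝ := fun i => ∑ j ∈ Finset.range (K + 1 - i), (v i (j+1) - v i j)^2 with hS
  have hSn : ∀ i, 0 ≤ S i := fun i => Finset.sum_nonneg fun j _ => sq_nonneg _
  have hVP : VP (K+1) v = ∑ i ∈ Finset.range (K+1), cw i * S i := rfl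
  have hVP0 : 0 ≤ VP (K+1) v := by
    rw [hVP]; exact Finset.sum_nonneg fun i _ => mul_nonneg (cw_pos i).le (hSn i)
  have hHP0 : 0 ≤ HP (K+1) v := Finset.sum_nonneg fun i _ => Finset.sum_nonneg fun j _ => sq_nonneg _
  -- strip
  have st1 : MP (K+1) v ≤ ∑ i ∈ Finset.range (K-1), ∑ j ∈ Finset.range (K - 1 - i), (v i (j+1))^2
      + 2 * (K+1) * VP (K+1) v := by
    have b1 : ∀ i, cw i * ∑ j ∈ Finset.range (K + 1 - i), (v i (j+1))^2 ≤
        ∑ j ∈ Finset.range (K - 1 - i), (v i (j+1))^2 + 2 * (K+1) * (cw i * S i) := by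
      intro i
      have t := tail2 (K+1-i) (fun j => (v i (j+1))^2) ((K+1) * S i) (mul_nonneg (by positivity) (hSn i))
        (fun j hj => by
          refine (tele (v i) (h0 i) (K+1-i) j hj).trans ?_
          refine mul_le_mul_of_nonneg_right ?_ (hSn i)
          have : K + 1 - i ≤ K + 1 := Nat.sub_le _ _
          exact_mod_cast this)
      have e : K + 1 - i - 2 = K - 1 - i := by omega
      rw [e] at t
      have t2 := mul_le_mul_of_nonneg_left t (cw_pos i).le
      have n1 : 0 ≤ ∑ j ∈ Finset.range (K - 1 - i), (v i (j+1))^2 := Finset.sum_nonneg fun _ _ => sq_nonneg _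
      have n2 := mul_le_mul_of_nonneg_right (cw_le i) n1
      nlinarith
    have b2 := Finset.sum_le_sum fun i (_ : i ∈ Finset.range (K+1)) => b1 i
    refine le_trans b2 (le_of_eq ?_)
    rw [Finset.sum_add_distrib, hVP, Finset.mul_sum]
    congr 1
    symm
    apply Finset.sum_subset
    · apply Finset.range_mono; omega
    · intro i _ hi
      have : K - 1 - i = 0 := by simp at hi; omega
      rw [this]; simp
  -- cells
  let R : ℕ → ℕ → ℝ := fun i j => (v i (j+1) - v i j)^2 + 2 * (v (i+1) (j+1) - v i (j+1))^2
      + 2 * (v (i+1) (j+1) - v (i+1) j)^2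
  have st2 : ∀ i j, i + j < K → a * b * (v i (j+1))^2 ≤ (1 + 1/K) * (∫ z in cell a b i j, f z ^ 2)
      + a * b * ((1 + K) * R i j) := by
    intro i j hij
    have hconst : ∀ c : ℝ, ∫ z in cell a b i j, c = a * b * c := by
      intro c
      rw [setIntegral_const, cell_vol a b ha hb]; rfl
    rw [← hconst, ← hconst, ← integral_const_mul, ← integral_add]
    · refine setIntegral_mono_on (cell_int _ _ _ _ _ continuous_const) ?_ (cell_meas _ _ _ _) ?_
      · exact cell_int _ _ _ _ _ ((continuous_const.mul (hc.pow 2)).add continuous_const)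
      · intro z hz
        obtain ⟨s0, s1, t0, t1⟩ := cell_st a b ha hb i j z hz
        have dv := Qf_dev v i j (z.1/a) (z.2/b) s0 s1 t0 t1
        rw [← hf i j hij z hz] at dv
        change _ ≤ R i j at dv
        have y : (v i (j+1))^2 ≤ (1 + 1/K) * f z ^ 2 + (1 + K) * (f z - v i (j+1))^2 := by
          have e : (1 + 1/K) * f z ^ 2 + (1 + K) * (f z - v i (j+1))^2 - (v i (j+1))^2
            = (f z + K * (f z - v i (j+1)))^2 / K := by field_simp; ring
          have : 0 ≤ (f z + K * (f z - v i (j+1)))^2 / K := by positivity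
          linarith
        have := mul_le_mul_of_nonneg_left dv (by positivity : (0:ℝ) ≤ 1 + K)
        linarith
    · exact cell_int _ _ _ _ _ (continuous_const.mul (hc.pow 2))
    · exact cell_int _ _ _ _ _ continuous_const
  have st3 : a * b * ∑ i ∈ Finset.range (K-1), ∑ j ∈ Finset.range (K - 1 - i), (v i (j+1))^2
     ≤ (1 + 1/K) * (∫ z in TH q h, f z ^ 2) +
       a * b * ((1 + K) * ∑ i ∈ Finset.range (K-1), ∑ j ∈ Finset.range (K - 1 - i), R i j) := by
    have g := cells_ge q h hq hh K hK (fun z => f z ^ 2) (fun z => sq_nonneg _) (hc.pow 2)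
    have g' := mul_le_mul_of_nonneg_left g (by positivity : (0:ℝ) ≤ 1 + 1/K)
    refine le_trans ?_ (add_le_add_left g' _)
    simp only [Finset.mul_sum, ← Finset.sum_add_distrib]
    refine Finset.sum_le_sum fun i hi => Finset.sum_le_sum fun j hj => ?_
    simp only [Finset.mem_range] at hi hj
    exact st2 i j (by omega)
  have hS2 : ∑ i ∈ Finset.range (K+1), S i ≤ 2 * VP (K+1) v := by
    rw [hVP, Finset.mul_sum]
    refine Finset.sum_le_sum fun i _ => ?_
    have : 1 ≤ 2 * cw i := by unfold cw; split_ifs <;> norm_num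
    nlinarith [hSn i]
  have st4 : ∑ i ∈ Finset.range (K-1), ∑ j ∈ Finset.range (K - 1 - i), R i j ≤ 6 * VP (K+1) v + 2 * HP (K+1) v := by
    have r1 : ∑ i ∈ Finset.range (K-1), ∑ j ∈ Finset.range (K - 1 - i), (v i (j+1) - v i j)^2 ≤ 2 * VP (K+1) v := by
      refine le_trans ?_ hS2
      refine le_trans (Finset.sum_le_sum (g := S) fun i _ => ?_) (Finset.sum_le_sum_of_subset_of_nonneg
        (Finset.range_mono (by omega)) fun i _ _ => hSn i)
      exact Finset.sum_le_sum_of_subset_of_nonneg (Finset.range_mono (by omega)) fun i _ _ => sq_nonneg _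
    have r2 : ∑ i ∈ Finset.range (K-1), ∑ j ∈ Finset.range (K - 1 - i), (v (i+1) (j+1) - v (i+1) j)^2 ≤ 2 * VP (K+1) v := by
      refine le_trans ?_ hS2
      refine le_trans (Finset.sum_le_sum (g := fun i => S (i+1)) fun i _ => ?_) ?_
      · exact Finset.sum_le_sum_of_subset_of_nonneg (Finset.range_mono (by omega)) fun i _ _ => sq_nonneg _
      · rw [Finset.sum_range_succ' S K]
        have := Finset.sum_le_sum_of_subset_of_nonneg (s := Finset.range (K-1)) (t := Finset.range K)
          (f := fun i => S (i+1)) (Finset.range_mono (by omega)) fun i _ _ => hSn _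
        linarith [hSn 0]
    have r3 : ∑ i ∈ Finset.range (K-1), ∑ j ∈ Finset.range (K - 1 - i), (v (i+1) (j+1) - v i (j+1))^2 ≤ HP (K+1) v := by
      unfold HP
      refine le_trans (Finset.sum_le_sum (g := fun i => ∑ j ∈ Finset.range (K + 1 - i - 1), (v (i+1) (j+1) - v i (j+1))^2) fun i _ => ?_) (Finset.sum_le_sum_of_subset_of_nonneg
        (Finset.range_mono (by omega)) fun i _ _ => Finset.sum_nonneg fun _ _ => sq_nonneg _)
      exact Finset.sum_le_sum_of_subset_of_nonneg (Finset.range_mono (by omega)) fun i _ _ => sq_nonneg _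
    simp only [R, Finset.sum_add_distrib, ← Finset.mul_sum]
    linarith
  have hab : q * h / K^2 = a * b := by rw [ha', hb']; field_simp
  have hab2 : a * b * (1 + K) ≤ 2 * q * h / K := by
    rw [← hab, div_mul_eq_mul_div, div_le_div_iff₀ (by positivity) hK']
    have : 0 < q * h := by positivity
    have h1 : q * h * (1 + K) ≤ q * h * (2 * K) := by apply mul_le_mul_of_nonneg_left _ this.le; linarith
    nlinarith
  rw [hab]
  have ab0 : 0 ≤ a * b := by positivity
  have m1 := mul_le_mul_of_nonneg_left st1 ab0
  have m2 : a * b * ((1 + K) * ∑ i ∈ Finset.range (K-1), ∑ j ∈ Finset.range (K - 1 - i), R i j)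
      ≤ a * b * ((1 + K) * (6 * VP (K+1) v + 2 * HP (K+1) v)) := by gcongr
  have m3 := mul_le_mul_of_nonneg_right hab2 (by positivity : 0 ≤ 8 * VP (K+1) v + 2 * HP (K+1) v)
  have m4 : 2 * q * h / K * (8 * VP (K+1) v + 2 * HP (K+1) v) ≤
     (16 * h^2 + 16 * q^2) / K * (h/q * HP (K+1) v + q/h * VP (K+1) v) := by
    have e : (16 * h^2 + 16 * q^2) / K * (h/q * HP (K+1) v + q/h * VP (K+1) v) -
      2 * q * h / K * (8 * VP (K+1) v + 2 * HP (K+1) v) =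
       ((16 * h^2 + 12 * q^2) * (h/q * HP (K+1) v) + 16 * q^2 * (q/h * VP (K+1) v)) / K := by
      field_simp; ring
    have : 0 ≤ ((16 * h^2 + 12 * q^2) * (h/q * HP (K+1) v) + 16 * q^2 * (q/h * VP (K+1) v)) / K := by positivity
    linarith
  nlinarith

def TT (p q h : ℝ) : Set (ℝ × ℝ) := {z | 0 < z.2 ∧ z.2 / h + z.1 / q < 1 ∧ z.2 / h - z.1 / p < 1}
def TTc (p q h : ℝ) : Set (ℝ × ℝ) := {z | 0 ≤ z.2 ∧ z.2 / h + z.1 / q ≤ 1 ∧ z.2 / h - z.1 / p ≤ 1}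

lemma TT_open (p q h : ℝ) : IsOpen (TT p q h) := by
  have h2 : IsOpen {z : ℝ × ℝ | 0 < z.2} := isOpen_lt continuous_const continuous_snd
  have h3 : IsOpen {z : ℝ × ℝ | z.2 / h + z.1 / q < 1} := isOpen_lt (by fun_prop) continuous_const
  have h4 : IsOpen {z : ℝ × ℝ | z.2 / h - z.1 / p < 1} := isOpen_lt (by fun_prop) continuous_const
  exact h2.inter (h3.inter h4)

def Rf : (ℝ × ℝ) ≃L[ℝ] (ℝ × ℝ) := (ContinuousLinearEquiv.neg ℝ).prodCongr (ContinuousLinearEquiv.refl ℝ ℝ)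

lemma Rf_apply (z : ℝ × ℝ) : Rf z = (-z.1, z.2) := rfl

lemma Rf_mp : MeasurePreserving (Rf : ℝ × ℝ → ℝ × ℝ) volume volume := by
  have := (Measure.measurePreserving_neg (volume : Measure ℝ)).prod (MeasurePreserving.id (volume : Measure ℝ))
  exact this

lemma Rf_emb : MeasurableEmbedding (Rf : ℝ × ℝ → ℝ × ℝ) :=
  Rf.toHomeomorph.measurableEmbedding

lemma TT_pos (p q h : ℝ) (hp : 0 < p) (hq : 0 < q) (hh : 0 < h) :
    TT p q h ∩ {z | 0 < z.1} = TH q h := by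
  ext z
  simp only [TT, TH, Set.mem_inter_iff, Set.mem_ofPred_eq]
  constructor
  · rintro ⟨⟨h1, h2, h3⟩, h4⟩; exact ⟨h4, h1, by linarith⟩
  · rintro ⟨h1, h2, h3⟩
    have a1 : 0 < z.1 / q := by positivity
    have a2 : 0 < z.1 / p := by positivity
    exact ⟨⟨h2, by linarith, by linarith⟩, h1⟩

lemma TT_neg (p q h : ℝ) (hp : 0 < p) (hq : 0 < q) (hh : 0 < h) :
    TT p q h ∩ {z | z.1 < 0} = Rf ⁻¹' TH p h := by
  ext z
  simp only [TT, TH, Set.mem_inter_iff, Set.mem_ofPred_eq, Set.mem_preimage, Rf_apply]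
  constructor
  · rintro ⟨⟨h1, h2, h3⟩, h4⟩; exact ⟨by linarith, h1, by rw [neg_div]; linarith⟩
  · rintro ⟨h1, h2, h3⟩
    rw [neg_div] at h3
    have a1 : 0 < (-z.1) / q := by positivity
    have a2 : 0 < (-z.1) / p := by positivity
    rw [neg_div] at a1 a2
    exact ⟨⟨h2, by linarith, by linarith⟩, by linarith⟩

lemma TT_split (p q h : ℝ) (hp : 0 < p) (hq : 0 < q) (hh : 0 < h) (g : ℝ × ℝ → ℝ)
    (hg : IntegrableOn g (TT p q h)) :
    ∫ z in TT p q h, g z = (∫ z in TH q h, g z) + ∫ z in TH p h, g (Rf z) := by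
  have hm : MeasurableSet {z : ℝ × ℝ | 0 < z.1} := (isOpen_lt continuous_const continuous_fst).measurableSet
  rw [← integral_inter_add_sdiff hm hg, TT_pos p q h hp hq hh]
  congr 1
  have e : (TT p q h \ {z | 0 < z.1} : Set (ℝ × ℝ)) =ᵐ[volume] (Rf ⁻¹' TH p h : Set (ℝ × ℝ)) := by
    rw [← TT_neg p q h hp hq hh]
    filter_upwards [ae_fst_ne 0] with z hz
    apply propext
    change (z ∈ TT p q h ∧ ¬ 0 < z.1) ↔ (z ∈ TT p q h ∧ z.1 < 0)
    rw [not_lt, le_iff_lt_or_eq]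
    simp [hz]
  rw [setIntegral_congr_set e]
  have := Rf_mp.setIntegral_preimage_emb Rf_emb (fun z => g (Rf z)) (TH p h)
  rw [← this]
  congr 1; ext z
  simp [Rf_apply]

lemma TT_sub (p q h : ℝ) (hp : 0 < p) (hq : 0 < q) (hh : 0 < h) :
    TT p q h ⊆ Set.Icc (-p) q ×ˢ Set.Icc 0 h := by
  rintro z ⟨h1, h2, h3⟩
  have a : 0 < z.2 / h := by positivity
  refine ⟨⟨?_, ?_⟩, h1.le, ?_⟩
  · have : (-z.1) / p < 1 := by rw [neg_div]; linarith
    rw [div_lt_one hp] at this; linarith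
  · have : z.1 / q < 1 := by linarith
    rw [div_lt_one hq] at this; linarith
  · rcases le_total 0 z.1 with hz | hz
    · have b : 0 ≤ z.1 / q := by positivity
      have : z.2 / h < 1 := by linarith
      rw [div_lt_one hh] at this; exact this.le
    · have b : 0 ≤ (-z.1) / p := div_nonneg (by linarith) hp.le
      rw [neg_div] at b
      have : z.2 / h < 1 := by linarith
      rw [div_lt_one hh] at this; exact this.le

lemma TT_bdd (p q h : ℝ) (hp : 0 < p) (hq : 0 < q) (hh : 0 < h) : Bornology.IsBounded (TT p q h) :=
  (isCompact_Icc.prod isCompact_Icc).isBounded.subset (TT_sub p q h hp hq hh)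

lemma fd_Rf (f : ℝ × ℝ → ℝ) (z : ℝ × ℝ) :
    (fderiv ℝ (fun z => f (Rf z)) z (1, 0))^2 = (fderiv ℝ f (Rf z) (1, 0))^2 ∧
    (fderiv ℝ (fun z => f (Rf z)) z (0, 1))^2 = (fderiv ℝ f (Rf z) (0, 1))^2 := by
  have : fderiv ℝ (fun z => f (Rf z)) z = (fderiv ℝ f (Rf z)).comp (Rf : (ℝ × ℝ) →L[ℝ] (ℝ × ℝ)) :=
    Rf.comp_right_fderiv (f := f)
  rw [this]
  constructor
  · have e : Rf (1, 0) = -((1, 0) : ℝ × ℝ) := by rw [Rf_apply]; simp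
    change (fderiv ℝ f (Rf z) (Rf (1, 0)))^2 = _
    rw [e, map_neg, neg_sq]
  · have e : Rf (0, 1) = ((0, 1) : ℝ × ℝ) := by rw [Rf_apply]; simp
    simp [e]

lemma grad_int (p q h : ℝ) (hp : 0 < p) (hq : 0 < q) (hh : 0 < h) (w : ℝ × ℝ → ℝ) (K : ℝ) (hK : 0 ≤ K)
    (hL : ∀ z ∈ TT p q h, ∀ z' ∈ TT p q h, |w z - w z'| ≤ K * ‖z - z'‖)
    (hd : ∀ᵐ z : ℝ × ℝ, z ∈ TT p q h → DifferentiableAt ℝ w z) :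
    IntegrableOn (fun z => (fderiv ℝ w z (1, 0))^2 + (fderiv ℝ w z (0, 1))^2) (TT p q h) := by
  have hfin : volume (TT p q h) < ⊤ := (TT_bdd p q h hp hq hh).measure_lt_top
  refine Measure.integrableOn_of_bounded (M := K^2 + K^2) hfin.ne ?_ ?_
  · exact (((measurable_fderiv_apply_const ℝ w (1, 0)).pow_const 2).add
      ((measurable_fderiv_apply_const ℝ w (0, 1)).pow_const 2)).aestronglyMeasurable
  · filter_upwards [ae_restrict_mem (TT_open p q h).measurableSet, ae_restrict_of_ae hd] with z hz hdz
    have hb : ‖fderiv ℝ w z‖ ≤ K := by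
      refine HasFDerivAt.le_of_lip' (hdz hz).hasFDerivAt hK ?_
      filter_upwards [(TT_open p q h).mem_nhds hz] with y hy
      exact hL y hy z hz
    refine (norm_add_le _ _).trans ?_
    rw [norm_pow, norm_pow]
    have a1 := (fderiv ℝ w z).le_of_opNorm_le hb (1, 0)
    have a2 := (fderiv ℝ w z).le_of_opNorm_le hb (0, 1)
    rw [norm_e1, mul_one] at a1
    rw [norm_e2, mul_one] at a2
    gcongr

lemma grad_split (p q h : ℝ) (hp : 0 < p) (hq : 0 < q) (hh : 0 < h) (w : ℝ × ℝ → ℝ)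
    (hg : IntegrableOn (fun z => (fderiv ℝ w z (1, 0))^2 + (fderiv ℝ w z (0, 1))^2) (TT p q h)) :
    ∫ z in TT p q h, ((fderiv ℝ w z (1, 0))^2 + (fderiv ℝ w z (0, 1))^2) =
     (∫ z in TH q h, ((fderiv ℝ w z (1, 0))^2 + (fderiv ℝ w z (0, 1))^2)) +
      ∫ z in TH p h, ((fderiv ℝ (fun z => w (Rf z)) z (1, 0))^2 + (fderiv ℝ (fun z => w (Rf z)) z (0, 1))^2) := by
  rw [TT_split p q h hp hq hh _ hg]
  congr 1
  congr 1; ext z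
  rw [(fd_Rf w z).1, (fd_Rf w z).2]

lemma Ph_at0 (M : ℕ) (v w : ℕ → ℕ → ℝ) (hvw : v 0 = w 0) (Y : ℝ) : Ph M v 0 Y = Ph M w 0 Y := by
  unfold Ph
  refine Finset.sum_congr rfl fun i _ => Finset.sum_congr rfl fun j _ => ?_
  rcases Nat.eq_zero_or_pos i with rfl | hi
  · rw [hvw]
  · have : (1:ℝ) ≤ i := by exact_mod_cast hi
    rw [tent_c (0 - i)]
    · ring
    · rw [abs_of_nonpos] <;> linarith

def GF (M : ℕ) (v w : ℕ → ℕ → ℝ) (a a' b : ℝ) (z : ℝ × ℝ) : ℝ :=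
  Ph M v (max z.1 0 / a) (z.2 / b) + Ph M w (max (-z.1) 0 / a') (z.2 / b) - Ph M v 0 (z.2 / b)

lemma GF_pos (M : ℕ) (v w : ℕ → ℕ → ℝ) (hvw : v 0 = w 0) (a a' b : ℝ) (z : ℝ × ℝ) (hz : 0 ≤ z.1) :
    GF M v w a a' b z = Ph M v (z.1 / a) (z.2 / b) := by
  unfold GF
  rw [max_eq_left hz, max_eq_right (by linarith : -z.1 ≤ 0), zero_div, Ph_at0 M v w hvw]
  ring

lemma GF_neg (M : ℕ) (v w : ℕ → ℕ → ℝ) (a a' b : ℝ) (z : ℝ × ℝ) (hz : z.1 ≤ 0) :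
    GF M v w a a' b z = Ph M w (-z.1 / a') (z.2 / b) := by
  unfold GF
  rw [max_eq_right hz, max_eq_left (by linarith : 0 ≤ -z.1), zero_div]
  ring

lemma lip_fst : Lip (fun z => z.1) := ⟨1, LipschitzWith.prod_fst⟩
lemma lip_snd : Lip (fun z => z.2) := ⟨1, LipschitzWith.prod_snd⟩
lemma lip_const (c : ℝ) : Lip (fun _ => c) := ⟨0, LipschitzWith.const c⟩
lemma Lip.divc {f : ℝ × ℝ → ℝ} (c : ℝ) (hf : Lip f) : Lip (fun z => f z / c) := by
  have := hf.cmul c⁻¹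
  simpa only [div_eq_inv_mul] using this
lemma Lip.max0 {f : ℝ × ℝ → ℝ} (hf : Lip f) : Lip (fun z => max (f z) 0) := by
  obtain ⟨K, hK⟩ := hf
  exact ⟨K, hK.max_const 0⟩

lemma GF_lip (M : ℕ) (v w : ℕ → ℕ → ℝ) (a a' b : ℝ) : Lip (GF M v w a a' b) := by
  unfold GF
  have hn : Lip (fun z => -z.1) := by simpa using lip_fst.cmul (-1)
  exact ((Ph_lip M v _ _ (lip_fst.max0.divc a) (lip_snd.divc b)).add
    (Ph_lip M w _ _ (hn.max0.divc a') (lip_snd.divc b))).sub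
    (Ph_lip M v _ _ (lip_const 0) (lip_snd.divc b))

lemma GF_cd (M : ℕ) (v w : ℕ → ℕ → ℝ) (hvw : v 0 = w 0) (a a' b : ℝ) (ha : 0 < a) (ha' : 0 < a') (hb : 0 < b) :
    ∀ᵐ z : ℝ × ℝ, HasStrictFDerivAt (GF M v w a a' b) (fderiv ℝ (GF M v w a a' b) z) z := by
  filter_upwards [ae_off a b, ae_off a' b] with z h1 h2
  suffices h : ContDiffAt ℝ 1 (GF M v w a a' b) z from h.hasStrictFDerivAt one_ne_zero
  have z0 : z.1 ≠ 0 := by simpa using h1.1 0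
  have ny : ∀ k : ℤ, z.2 / b ≠ k := by
    intro k hk; rw [div_eq_iff hb.ne'] at hk; exact h1.2 k hk
  rcases lt_or_gt_of_ne z0 with hz | hz
  · refine (Ph_cd M w (fun z => -z.1 / a') (fun z => z.2 / b) z (by fun_prop) (by fun_prop) ?_ ny).congr_of_eventuallyEq ?_
    · intro k hk
      rw [div_eq_iff ha'.ne'] at hk
      exact h2.1 (-k) (by push_cast; linarith)
    · filter_upwards [(isOpen_lt continuous_fst continuous_const : IsOpen {z : ℝ × ℝ | z.1 < 0}).mem_nhds hz] with y hy
      exact GF_neg M v w a a' b y (le_of_lt hy)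
  · refine (Ph_cd M v (fun z => z.1 / a) (fun z => z.2 / b) z (by fun_prop) (by fun_prop) ?_ ny).congr_of_eventuallyEq ?_
    · intro k hk
      rw [div_eq_iff ha.ne'] at hk
      exact h1.1 k hk
    · filter_upwards [(isOpen_lt continuous_const continuous_fst : IsOpen {z : ℝ × ℝ | 0 < z.1}).mem_nhds hz] with y hy
      exact GF_pos M v w hvw a a' b y (le_of_lt hy)

lemma Ph_interp (q h : ℝ) (hq : 0 < q) (hh : 0 < h) (K : ℕ) (hK : 0 < K) (v : ℕ → ℕ → ℝ) (f : ℝ × ℝ → ℝ)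
    (hf : ∀ z, 0 ≤ z.1 → f z = Ph (K+2) v (z.1 / (q/K)) (z.2 / (h/K))) : Interp q h K v f := by
  intro i j hij z hz
  have hK' : (0:ℝ) < K := by exact_mod_cast hK
  have ha : 0 < q / K := by positivity
  have hb : 0 < h / K := by positivity
  have hm := (mem_cell _ _ ha hb i j z).mp hz
  obtain ⟨s0, s1, t0, t1⟩ := cell_st _ _ ha hb i j z hz
  rw [hf z hm.1.1]
  exact Ph_loc _ v i j (by omega) (by omega) _ _ (by linarith) (by linarith) (by linarith) (by linarith)

def TestH (p q h Λ : ℝ) : Prop := ∀ v : ℝ × ℝ → ℝ, ContDiff ℝ 1 v → (∀ z, z.2 ≤ 0 → v z = 0) →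
      Λ * ∫ z in TT p q h, v z ^ 2 ≤ ∫ z in TT p q h, ((fderiv ℝ v z (1, 0))^2 + (fderiv ℝ v z (0, 1))^2)

lemma level (p q h Λ : ℝ) (hp : 0 < p) (hq : 0 < q) (hh : 0 < h) (hΛ : 0 ≤ Λ) (H : TestH p q h Λ)
    (K : ℕ) (hK : 0 < K) : ∃ l : ℝ,
      Λ * (h / K^2) ≤ (1 + (1 + Λ * (16 * h^2 + 16 * q^2 + 16 * p^2)) / K) * l ∧
      ∀ U W : ℕ → ℕ → ℝ, (∀ i j, K + 1 ≤ i + j → U i j = 0) → (∀ i j, K + 1 ≤ i + j → W i j = 0) →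
        U 0 = W 0 → l * ME p q (K+1) U W U W ≤ EE p q h (K+1) U W U W := by
  obtain ⟨l, v, w, hv0, hw0, hvw, hM, hE, hl⟩ := discrete_main p q h hp hq hh (K+1) (by omega)
  refine ⟨l, ?_, hl⟩
  have hK' : (0:ℝ) < K := by exact_mod_cast hK
  have ha : 0 < q / K := by positivity
  have ha' : 0 < p / K := by positivity
  have hb : 0 < h / K := by positivity
  set f := GF (K+2) v w (q/K) (p/K) (h/K) with hf
  obtain ⟨L, hL⟩ := GF_lip (K+2) v w (q/K) (p/K) (h/K)
  have hcd := GF_cd (K+2) v w hvw (q/K) (p/K) (h/K) ha ha' hb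
  rw [← hf] at hL hcd
  have hfc : Continuous f := hL.continuous
  have hf0 : ∀ z, z.2 ≤ 0 → f z = 0 := by
    intro z hz
    have : z.2 / (h/K) ≤ 0 := div_nonpos_of_nonpos_of_nonneg hz hb.le
    rw [hf]; unfold GF
    rw [Ph_zero _ v hv0 _ _ this, Ph_zero _ w hw0 _ _ this, Ph_zero _ v hv0 _ _ this]; ring
  have I1 : Interp q h K v f := Ph_interp q h hq hh K hK v f fun z hz => GF_pos _ v w hvw _ _ _ z hz
  have I2 : Interp p h K w (fun z => f (Rf z)) := Ph_interp p h hp hh K hK w _ fun z hz => by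
    rw [hf, GF_neg _ v w _ _ _ _ (by rw [Rf_apply]; simpa using hz), Rf_apply]
    simp
  have R := relax (TT p q h) (TT_open p q h).measurableSet (TT_bdd p q h hp hq hh) Λ H f L hL hf0 hcd
  have gi : IntegrableOn (fun z => (fderiv ℝ f z (1, 0))^2 + (fderiv ℝ f z (0, 1))^2) (TT p q h) := by
    refine grad_int p q h hp hq hh f L L.2 (fun z _ z' _ => ?_) ?_
    · have := hL.dist_le_mul z z'
      rwa [Real.dist_eq, dist_eq_norm] at this
    · filter_upwards [hcd] with z hz _
      exact hz.differentiableAt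
  rw [grad_split p q h hp hq hh f gi] at R
  have mi : IntegrableOn (fun z => f z ^ 2) (TT p q h) :=
    ((hfc.pow 2).continuousOn.integrableOn_compact (isCompact_Icc.prod isCompact_Icc)).mono_set (TT_sub p q h hp hq hh)
  rw [TT_split p q h hp hq hh _ mi] at R
  have g1 := half_grad q h hq hh K hK v hv0 f I1
  have g2 := half_grad p h hp hh K hK w hw0 _ I2
  have m1 := half_mass q h hq hh K hK v hv0 f I1 hfc
  have m2 := half_mass p h hp hh K hK w hw0 _ I2 (hfc.comp Rf.continuous)
  set A1 := ∫ z in TH q h, f z ^ 2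
  set A2 := ∫ z in TH p h, f (Rf z) ^ 2
  set E1 := h/q * HP (K+1) v + q/h * VP (K+1) v with hE1
  set E2 := h/p * HP (K+1) w + p/h * VP (K+1) w with hE2
  have HPn : ∀ u : ℕ → ℕ → ℝ, 0 ≤ HP (K+1) u := fun u => Finset.sum_nonneg fun i _ => Finset.sum_nonneg fun j _ => sq_nonneg _
  have VPn : ∀ u : ℕ → ℕ → ℝ, 0 ≤ VP (K+1) u := fun u => Finset.sum_nonneg fun i _ =>
    mul_nonneg (cw_pos i).le (Finset.sum_nonneg fun j _ => sq_nonneg _)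
  have E1n : 0 ≤ E1 := by have := HPn v; have := VPn v; positivity
  have E2n : 0 ≤ E2 := by have := HPn w; have := VPn w; positivity
  set C := 16 * h^2 + 16 * q^2 + 16 * p^2 with hC
  have c1 : (16 * h^2 + 16 * q^2) / K * E1 ≤ C / K * E1 := by
    refine mul_le_mul_of_nonneg_right ?_ E1n
    refine div_le_div_of_nonneg_right ?_ hK'.le
    nlinarith [sq_nonneg p]
  have c2 : (16 * h^2 + 16 * p^2) / K * E2 ≤ C / K * E2 := by
    refine mul_le_mul_of_nonneg_right ?_ E2n
    refine div_le_div_of_nonneg_right ?_ hK'.le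
    nlinarith [sq_nonneg q]
  have mm : h / K^2 * (q * MP (K+1) v + p * MP (K+1) w) ≤ (1 + 1/K) * (A1 + A2) + C / K * (E1 + E2) := by
    have e : h / K^2 * (q * MP (K+1) v + p * MP (K+1) w) = q * h / K^2 * MP (K+1) v + p * h / K^2 * MP (K+1) w := by ring
    rw [e]
    linarith
  have R' : Λ * (A1 + A2) ≤ E1 + E2 := by linarith
  have n1 : (0:ℝ) ≤ 1 + 1/K := by positivity
  have k1 := mul_le_mul_of_nonneg_left mm hΛ
  have k2 := mul_le_mul_of_nonneg_left R' n1
  have k3 : Λ * (h / K^2) * (q * MP (K+1) v + p * MP (K+1) w) ≤ (1 + (1 + Λ * C) / K) * (E1 + E2) := by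
    have e : (1 + (1 + Λ * C) / K) * (E1 + E2) = (1 + 1/K) * (E1 + E2) + Λ * (C / K * (E1 + E2)) := by ring
    rw [e]; nlinarith
  have n2 : (0:ℝ) ≤ 1 + (1 + Λ * C) / K := by positivity
  have k4 := mul_le_mul_of_nonneg_left hE n2
  have k5 : Λ * (h / K^2) * (q * MP (K+1) v + p * MP (K+1) w) ≤ ((1 + (1 + Λ * C) / K) * l) * (q * MP (K+1) v + p * MP (K+1) w) := by
    linarith
  exact le_of_mul_le_mul_right k5 hM

lemma comp_int (T : Set (ℝ × ℝ)) (hT : IsOpen T) (hB : Bornology.IsBounded T) (w : ℝ × ℝ → ℝ) (K : ℝ) (hK : 0 ≤ K)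
    (hL : ∀ z ∈ T, ∀ z' ∈ T, |w z - w z'| ≤ K * ‖z - z'‖)
    (hd : ∀ z ∈ T, DifferentiableAt ℝ w z) :
    IntegrableOn (fun z => (fderiv ℝ w z (1, 0))^2) T ∧ IntegrableOn (fun z => (fderiv ℝ w z (0, 1))^2) T := by
  have hfin : volume T < ⊤ := hB.measure_lt_top
  have hb : ∀ z ∈ T, ‖fderiv ℝ w z‖ ≤ K := by
    intro z hz
    refine HasFDerivAt.le_of_lip' (hd z hz).hasFDerivAt hK ?_
    filter_upwards [hT.mem_nhds hz] with y hy
    exact hL y hy z hz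
  constructor
  · refine Measure.integrableOn_of_bounded (M := K^2) hfin.ne ((measurable_fderiv_apply_const ℝ w (1, 0)).pow_const 2).aestronglyMeasurable ?_
    filter_upwards [ae_restrict_mem hT.measurableSet] with z hz
    rw [norm_pow]
    have a1 := (fderiv ℝ w z).le_of_opNorm_le (hb z hz) (1, 0)
    rw [norm_e1, mul_one] at a1
    gcongr
  · refine Measure.integrableOn_of_bounded (M := K^2) hfin.ne ((measurable_fderiv_apply_const ℝ w (0, 1)).pow_const 2).aestronglyMeasurable ?_
    filter_upwards [ae_restrict_mem hT.measurableSet] with z hz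
    rw [norm_pow]
    have a1 := (fderiv ℝ w z).le_of_opNorm_le (hb z hz) (0, 1)
    rw [norm_e2, mul_one] at a1
    gcongr

theorem core (p q h Λ : ℝ) (hp : 0 < p) (hq : 0 < q) (hh : 0 < h) (hΛ : 0 ≤ Λ) (H : TestH p q h Λ)
    (w : ℝ × ℝ → ℝ) (K : ℝ) (hK0 : 0 ≤ K)
    (hL : ∀ z ∈ TTc p q h, ∀ z' ∈ TTc p q h, |w z - w z'| ≤ K * ‖z - z'‖)
    (h0 : ∀ z ∈ TTc p q h, (z.2 / h + z.1 / q = 1 ∨ z.2 / h - z.1 / p = 1) → w z = 0)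
    (hd : ∀ z ∈ TT p q h, HasStrictFDerivAt w (fderiv ℝ w z) z) :
    Λ * ∫ z in TT p q h, w z ^ 2 ≤ ∫ z in TT p q h, ((fderiv ℝ w z (1, 0))^2 + (fderiv ℝ w z (0, 1))^2) := by
  have sub1 : TC q h ⊆ TTc p q h := by
    rintro z ⟨h1, h2, h3⟩
    have a1 : 0 ≤ z.1 / p := by positivity
    have a2 : 0 ≤ z.1 / q := by positivity
    exact ⟨h2, by linarith, by linarith⟩
  have sub2 : ∀ z ∈ TC p h, Rf z ∈ TTc p q h := by
    rintro z ⟨h1, h2, h3⟩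
    have a1 : 0 ≤ z.1 / p := by positivity
    have a2 : 0 ≤ z.1 / q := by positivity
    rw [Rf_apply]
    refine ⟨h2, ?_, ?_⟩
    · simp only [neg_div]; linarith
    · simp only [neg_div]; linarith
  have subT : TT p q h ⊆ TTc p q h := fun z hz => ⟨hz.1.le, hz.2.1.le, hz.2.2.le⟩
  have sT1 : TH q h ⊆ TT p q h := by
    rw [← TT_pos p q h hp hq hh]; exact Set.inter_subset_left
  have sT2 : ∀ z ∈ TH p h, Rf z ∈ TT p q h := by
    intro z hz
    have : Rf z ∈ TT p q h ∩ {z | z.1 < 0} := by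
      rw [TT_neg p q h hp hq hh]
      simpa [Rf_apply] using hz
    exact this.1
  let wl : ℝ × ℝ → ℝ := fun z => w (Rf z)
  have nR : ∀ z z' : ℝ × ℝ, ‖Rf z - Rf z'‖ = ‖z - z'‖ := by
    intro z z'
    rw [Rf_apply, Rf_apply, Prod.norm_def, Prod.norm_def]
    congr 1
    simp only [Prod.fst_sub]
    rw [← norm_neg]; congr 1; ring
  have L1 : ∀ z ∈ TC q h, ∀ z' ∈ TC q h, |w z - w z'| ≤ K * ‖z - z'‖ :=
    fun z hz z' hz' => hL z (sub1 hz) z' (sub1 hz')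
  have L2 : ∀ z ∈ TC p h, ∀ z' ∈ TC p h, |wl z - wl z'| ≤ K * ‖z - z'‖ := by
    intro z hz z' hz'
    have := hL _ (sub2 z hz) _ (sub2 z' hz')
    rwa [nR] at this
  have Z1 : ∀ z ∈ TC q h, z.1 / q + z.2 / h = 1 → w z = 0 := fun z hz e =>
    h0 z (sub1 hz) (Or.inl (by linarith))
  have Z2 : ∀ z ∈ TC p h, z.1 / p + z.2 / h = 1 → wl z = 0 := fun z hz e =>
    h0 _ (sub2 z hz) (Or.inr (by rw [Rf_apply]; simp only [neg_div]; linarith))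
  have D1 : ∀ z ∈ TH q h, HasStrictFDerivAt w (fderiv ℝ w z) z := fun z hz => hd z (sT1 hz)
  have D2 : ∀ z ∈ TH p h, HasStrictFDerivAt wl (fderiv ℝ wl z) z := by
    intro z hz
    have h1 : HasStrictFDerivAt wl _ z := (hd _ (sT2 z hz)).comp z Rf.hasStrictFDerivAt
    have h2 := h1.hasFDerivAt.fderiv
    rw [h2]; exact h1
  -- integrability
  have gi := grad_int p q h hp hq hh w K hK0 (fun z hz z' hz' => hL z (subT hz) z' (subT hz'))
    (Eventually.of_forall fun z hz => (hd z hz).differentiableAt)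
  have wc : ContinuousOn w (TT p q h) := fun z hz => (hd z hz).continuousAt.continuousWithinAt
  obtain ⟨Rd, hRd⟩ := (TT_bdd p q h hp hq hh).exists_norm_le
  have mi : IntegrableOn (fun z => w z ^ 2) (TT p q h) := by
    have z0m : ((0, h) : ℝ × ℝ) ∈ TTc p q h := by
      refine ⟨hh.le, ?_, ?_⟩ <;> simp [hh.ne']
    have w0 : w (0, h) = 0 := h0 _ z0m (Or.inl (by simp [hh.ne']))
    have : IsFiniteMeasure (volume.restrict (TT p q h)) :=
      ⟨by rw [Measure.restrict_apply_univ]; exact (TT_bdd p q h hp hq hh).measure_lt_top⟩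
    refine Integrable.of_bound (C := (K * (Rd + h))^2) ?_ ?_
    · exact (wc.pow 2).aestronglyMeasurable (TT_open p q h).measurableSet
    · filter_upwards [ae_restrict_mem (TT_open p q h).measurableSet] with z hz
      rw [norm_pow]
      refine pow_le_pow_left₀ (norm_nonneg _) ?_ 2
      have := hL z (subT hz) _ z0m
      rw [w0, sub_zero] at this
      refine this.trans ?_
      gcongr
      refine (norm_sub_le _ _).trans ?_
      have e : ‖((0, h) : ℝ × ℝ)‖ = h := by simp [Prod.norm_def, abs_of_pos hh, hh.le]
      rw [e]
      linarith [hRd z hz]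
  obtain ⟨i1, i2⟩ := comp_int (TH q h) (TH_open q h) ((isCompact_Icc.prod isCompact_Icc).isBounded.subset (TH_bdd q h hq hh)) w K hK0
    (fun z hz z' hz' => hL z (subT (sT1 hz)) z' (subT (sT1 hz'))) (fun z hz => (D1 z hz).differentiableAt)
  obtain ⟨i3, i4⟩ := comp_int (TH p h) (TH_open p h) ((isCompact_Icc.prod isCompact_Icc).isBounded.subset (TH_bdd p h hp hh)) wl K hK0
    (fun z hz z' hz' => by
      have := hL _ (subT (sT2 z hz)) _ (subT (sT2 z' hz'))
      rwa [nR] at this) (fun z hz => (D2 z hz).differentiableAt)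
  rw [grad_split p q h hp hq hh w gi, TT_split p q h hp hq hh _ mi, integral_add i1 i2]
  have e3 := integral_add i3 i4
  have H1 := samp_H q h hq hh w K hK0 L1 Z1 D1
  have H2 := samp_V q h hq hh w K hK0 L1 Z1 D1
  have H3 := samp_M q h hq hh w K hK0 L1 Z1 D1
  have H4 := samp_H p h hp hh wl K hK0 L2 Z2 D2
  have H5 := samp_V p h hp hh wl K hK0 L2 Z2 D2
  have H6 := samp_M p h hp hh wl K hK0 L2 Z2 D2
  have LM := ((H3.add H6).const_mul Λ).comp (tendsto_add_atTop_nat 1)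
  have LE := ((H1.add H2).add (H4.add H5)).comp (tendsto_add_atTop_nat 1)
  let Cc : ℝ := 1+Λ*(16*h^2+16*q^2+16*p^2)
  have hCc : 0 ≤ Cc := by positivity
  have LC : Tendsto (fun K : ℕ => 1 + Cc / K) atTop (𝓝 (1 + 0)) :=
    tendsto_const_nhds.add (tendsto_const_div_atTop_nhds_zero_nat Cc)
  have LR := LC.mul LE
  have e4 : (∫ z in TH p h, ((fderiv ℝ (fun z => w (Rf z)) z (1, 0))^2 + (fderiv ℝ (fun z => w (Rf z)) z (0, 1))^2)) = _ := e3
  rw [e4]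
  rw [add_zero, one_mul] at LR
  refine le_of_tendsto_of_tendsto LM LR ?_
  filter_upwards [eventually_ge_atTop 1] with n hn
  obtain ⟨l, hl, hlU⟩ := level p q h Λ hp hq hh hΛ H n hn
  have hU : ∀ i j, n + 1 ≤ i + j → smp q h w (n+1) i j = 0 := by
    intro i j hij; unfold smp; rw [if_neg (by omega)]
  have hW : ∀ i j, n + 1 ≤ i + j → smp p h wl (n+1) i j = 0 := by
    intro i j hij; unfold smp; rw [if_neg (by omega)]
  have h00 : smp q h w (n+1) 0 = smp p h wl (n+1) 0 := by
    funext j; simp [smp, wl, Rf_apply]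
  have key := hlU _ _ hU hW h00
  have m1 := MM_nonneg (n+1) (smp q h w (n+1))
  have m2 := MM_nonneg (n+1) (smp p h wl (n+1))
  have hME : 0 ≤ ME p q (n+1) (smp q h w (n+1)) (smp p h wl (n+1)) (smp q h w (n+1)) (smp p h wl (n+1)) := by
    unfold ME; positivity
  have hnp : (0:ℝ) < n := by exact_mod_cast hn
  have k1 : h / (((n+1 : ℕ) : ℝ) + 1/2)^2 ≤ h / (n:ℝ)^2 := by
    push_cast
    gcongr
    linarith
  have hc1 : 0 ≤ 1 + Cc / n := by positivity
  have k2 := mul_le_mul_of_nonneg_right (mul_le_mul_of_nonneg_left k1 hΛ) hME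
  have k3 := mul_le_mul_of_nonneg_right hl hME
  have k4 := mul_le_mul_of_nonneg_left key hc1
  have k5 := k2.trans (k3.trans ((mul_assoc _ _ _).le.trans k4))
  refine Eq.trans_le ?_ (k5.trans_eq ?_)
  · simp only [Function.comp, ME]; ring
  · simp only [Function.comp, EE]

def Lc (b : OrthonormalBasis (Fin 2) ℝ Pt) : (ℝ × ℝ) ≃L[ℝ] Pt :=
  ((ContinuousLinearEquiv.finTwoArrow ℝ ℝ).symm.trans (PiLp.continuousLinearEquiv 2 ℝ (fun _ : Fin 2 => ℝ)).symm).trans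
    b.repr.symm.toContinuousLinearEquiv

lemma Lc_apply (b : OrthonormalBasis (Fin 2) ℝ Pt) (z : ℝ × ℝ) : Lc b z = z.1 • b 0 + z.2 • b 1 := by
  change b.repr.symm _ = _
  rw [← b.sum_repr_symm, Fin.sum_univ_two]
  rfl

lemma Lc_mp (b : OrthonormalBasis (Fin 2) ℝ Pt) : MeasurePreserving (Lc b) volume volume := by
  have h1 := (volume_preserving_finTwoArrow ℝ).symm
  have h2 := PiLp.volume_preserving_toLp (Fin 2)
  have h3 := b.repr.symm.measurePreserving
  exact h3.comp (h2.comp h1)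

def Phi (F : Pt) (b : OrthonormalBasis (Fin 2) ℝ Pt) : (ℝ × ℝ) ≃ₜ Pt :=
  (Lc b).toHomeomorph.trans (Homeomorph.addLeft F)

lemma Phi_apply (F : Pt) (b : OrthonormalBasis (Fin 2) ℝ Pt) (z : ℝ × ℝ) : Phi F b z = F + Lc b z := rfl
lemma Phi_symm (F : Pt) (b : OrthonormalBasis (Fin 2) ℝ Pt) (x : Pt) : (Phi F b).symm x = (Lc b).symm (x - F) := by
  rw [Homeomorph.symm_apply_eq, Phi_apply]; simp

lemma Phi_mp (F : Pt) (b : OrthonormalBasis (Fin 2) ℝ Pt) : MeasurePreserving (Phi F b) volume volume :=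
  (measurePreserving_add_left volume F).comp (Lc_mp b)

lemma Phi_int (F : Pt) (b : OrthonormalBasis (Fin 2) ℝ Pt) (Om : Set Pt) (g : Pt → ℝ) :
    ∫ x in Om, g x = ∫ z in (Phi F b) ⁻¹' Om, g (Phi F b z) :=
  ((Phi_mp F b).setIntegral_preimage_emb (Phi F b).measurableEmbedding g Om).symm

lemma Phi_grad (F : Pt) (b : OrthonormalBasis (Fin 2) ℝ Pt) (u : Pt → ℝ) (z : ℝ × ℝ) :
    (pd 0 u (Phi F b z))^2 + (pd 1 u (Phi F b z))^2 =
    (fderiv ℝ (fun z => u (Phi F b z)) z (1, 0))^2 + (fderiv ℝ (fun z => u (Phi F b z)) z (0, 1))^2 := by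
  have e : fderiv ℝ (fun z => u (Phi F b z)) z = (fderiv ℝ u (Phi F b z)).comp (Lc b : (ℝ × ℝ) →L[ℝ] Pt) := by
    have h1 : fderiv ℝ ((fun y => u (F + y)) ∘ (Lc b)) z = (fderiv ℝ (fun y => u (F + y)) (Lc b z)).comp (Lc b : (ℝ × ℝ) →L[ℝ] Pt) :=
      (Lc b).comp_right_fderiv
    rw [fderiv_comp_add_left] at h1
    exact h1
  rw [e]
  simp only [ContinuousLinearMap.comp_apply, ContinuousLinearEquiv.coe_coe, Lc_apply, pd]
  simp only [one_smul, zero_smul, add_zero, zero_add]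
  generalize fderiv ℝ u (Phi F b z) = l
  have h1 := b.norm_dual l
  have h2 := (EuclideanSpace.basisFun (Fin 2) ℝ).norm_dual l
  simp [Fin.sum_univ_two] at h1 h2
  linarith

lemma lip_of_cd (s : Set (ℝ × ℝ)) (hs : Convex ℝ s) (hc : IsCompact s) (hi : (interior s).Nonempty)
    (w : ℝ × ℝ → ℝ) (hw : ContDiffOn ℝ 1 w s) : ∃ K : ℝ, 0 ≤ K ∧ ∀ z ∈ s, ∀ z' ∈ s, |w z - w z'| ≤ K * ‖z - z'‖ := by
  have hu : UniqueDiffOn ℝ s := uniqueDiffOn_convex hs hi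
  have hcf := hw.continuousOn_fderivWithin hu le_rfl
  obtain ⟨K, hK⟩ := hc.exists_bound_of_continuousOn hcf
  refine ⟨max K 0, le_max_right _ _, fun z hz z' hz' => ?_⟩
  exact hs.norm_image_sub_le_of_norm_fderivWithin_le (hw.differentiableOn one_ne_zero)
    (fun x hx => (hK x hx).trans (le_max_left _ _)) hz' hz

lemma int_half (f : (ℝ × ℝ) →L[ℝ] ℝ) (hf : ∃ z, f z ≠ 0) (c : ℝ) : interior {z | f z ≤ c} = {z | f z < c} := by
  have hs : Function.Surjective f := by
    obtain ⟨z, hz⟩ := hf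
    intro r
    exact ⟨(r / f z) • z, by simp [hz]⟩
  have := (f.isOpenMap hs).preimage_interior_eq_interior_preimage f.continuous (Set.Iic c)
  rw [interior_Iic] at this
  exact this.symm

lemma TTc_int (p q h : ℝ) (hp : 0 < p) (hq : 0 < q) (hh : 0 < h) : interior (TTc p q h) = TT p q h := by
  let f1 : (ℝ × ℝ) →L[ℝ] ℝ := -ContinuousLinearMap.snd ℝ ℝ ℝ
  let f2 : (ℝ × ℝ) →L[ℝ] ℝ := h⁻¹ • ContinuousLinearMap.snd ℝ ℝ ℝ + q⁻¹ • ContinuousLinearMap.fst ℝ ℝ ℝ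
  let f3 : (ℝ × ℝ) →L[ℝ] ℝ := h⁻¹ • ContinuousLinearMap.snd ℝ ℝ ℝ - p⁻¹ • ContinuousLinearMap.fst ℝ ℝ ℝ
  have e1 : TTc p q h = {z | f1 z ≤ 0} ∩ ({z | f2 z ≤ 1} ∩ {z | f3 z ≤ 1}) := by
    ext z; simp [TTc, f1, f2, f3, div_eq_inv_mul]
  rw [e1, interior_inter, interior_inter, int_half f1 ⟨(0, 1), by simp [f1]⟩, int_half f2 ⟨(0, 1), by simp [f2, hh.ne']⟩,
    int_half f3 ⟨(0, 1), by simp [f3, hh.ne']⟩]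
  ext z; simp [TT, f1, f2, f3, div_eq_inv_mul]

lemma TTc_convex (p q h : ℝ) : Convex ℝ (TTc p q h) := by
  rintro x ⟨x1, x2, x3⟩ y ⟨y1, y2, y3⟩ a b ha hb hab
  simp only [TTc, Set.mem_ofPred_eq, Prod.fst_add, Prod.snd_add, Prod.smul_fst, Prod.smul_snd, smul_eq_mul]
  refine ⟨by positivity, ?_, ?_⟩
  · have h1 := mul_le_mul_of_nonneg_left x2 ha
    have h2 := mul_le_mul_of_nonneg_left y2 hb
    calc _ = a * (x.2 / h + x.1 / q) + b * (y.2 / h + y.1 / q) := by ring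
      _ ≤ 1 := by linarith
  · have h1 := mul_le_mul_of_nonneg_left x3 ha
    have h2 := mul_le_mul_of_nonneg_left y3 hb
    calc _ = a * (x.2 / h - x.1 / p) + b * (y.2 / h - y.1 / p) := by ring
      _ ≤ 1 := by linarith

lemma TTc_hull (p q h : ℝ) (hp : 0 < p) (hq : 0 < q) (hh : 0 < h) :
    convexHull ℝ {((-p, 0) : ℝ × ℝ), (q, 0), (0, h)} = TTc p q h := by
  apply Set.Subset.antisymm
  · refine convexHull_min ?_ (TTc_convex p q h)
    rintro z (rfl | rfl | rfl)
    · have : 0 < p / q := by positivity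
      refine ⟨le_rfl, ?_, ?_⟩ <;> simp [neg_div, hp.ne']
      linarith
    · have : 0 < q / p := by positivity
      refine ⟨le_rfl, ?_, ?_⟩ <;> simp [hq.ne']
      linarith
    · refine ⟨hh.le, ?_, ?_⟩ <;> simp [hh.ne']
  · rintro z ⟨h1, h2, h3⟩
    have a2 : z.1 ≤ q * (1 - z.2 / h) := by
      have : z.1 / q ≤ 1 - z.2 / h := by linarith
      rw [div_le_iff₀ hq] at this; linarith
    have a3 : -z.1 ≤ p * (1 - z.2 / h) := by
      have : (-z.1) / p ≤ 1 - z.2 / h := by rw [neg_div]; linarith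
      rw [div_le_iff₀ hp] at this; linarith
    have hz2 : 0 ≤ z.2 / h := by positivity
    have hc := convex_convexHull ℝ {((-p, 0) : ℝ × ℝ), (q, 0), (0, h)}
    have m1 : ((-p, 0) : ℝ × ℝ) ∈ convexHull ℝ {((-p, 0) : ℝ × ℝ), (q, 0), (0, h)} := subset_convexHull _ _ (by simp)
    have m2 : ((q, 0) : ℝ × ℝ) ∈ convexHull ℝ {((-p, 0) : ℝ × ℝ), (q, 0), (0, h)} := subset_convexHull _ _ (by simp)
    have m3 : ((0, h) : ℝ × ℝ) ∈ convexHull ℝ {((-p, 0) : ℝ × ℝ), (q, 0), (0, h)} := subset_convexHull _ _ (by simp)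
    have := hc.sum_mem (t := Finset.univ) (w := ![(q * (1 - z.2 / h) - z.1) / (p + q), (z.1 + p * (1 - z.2 / h)) / (p + q), z.2 / h])
      (z := ![((-p, 0) : ℝ × ℝ), (q, 0), (0, h)]) ?_ ?_ ?_
    · convert this using 1
      simp only [Fin.sum_univ_three]
      ext
      · simp; field_simp; ring
      · simp; field_simp
    · intro i _
      fin_cases i
      · exact div_nonneg (by linarith) (by linarith)
      · exact div_nonneg (by linarith) (by linarith)
      · exact hz2
    · simp only [Fin.sum_univ_three]; simp; field_simp; ring
    · intro i _
      fin_cases i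
      · exact m1
      · exact m2
      · exact m3

lemma geom (A B C : Pt) (hnd : AffineIndependent ℝ ![A, B, C])
    (hSM : dist B C ≤ dist A C) (hML : dist A C ≤ dist A B) :
    ∃ (p q h : ℝ) (F : Pt) (b : OrthonormalBasis (Fin 2) ℝ Pt), 0 < p ∧ 0 < q ∧ 0 < h ∧
      A = Phi F b (-p, 0) ∧ B = Phi F b (q, 0) ∧ C = Phi F b (0, h) := by
  have hAB : A ≠ B := by
    intro e
    have := hnd.injective (a₁ := 0) (a₂ := 1) (by simpa using e)
    simp at this
  have hAC : A ≠ C := by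
    intro e
    have := hnd.injective (a₁ := 0) (a₂ := 2) (by simpa using e)
    simp at this
  have hBC : B ≠ C := by
    intro e
    have := hnd.injective (a₁ := 1) (a₂ := 2) (by simpa using e)
    simp at this
  set c : ℝ := ‖B - A‖ with hc
  have hc0 : 0 < c := norm_pos_iff.2 (sub_ne_zero.2 hAB.symm)
  set e : Pt := c⁻¹ • (B - A) with he
  have hen : ‖e‖ = 1 := by rw [he, norm_smul, norm_inv, Real.norm_of_nonneg hc0.le, ← hc, inv_mul_cancel₀ hc0.ne']
  have hee : inner ℝ e e = 1 := by rw [real_inner_self_eq_norm_sq, hen]; norm_num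
  have hBA : B - A = c • e := by rw [he, smul_smul, mul_inv_cancel₀ hc0.ne', one_smul]
  set p : ℝ := inner ℝ e (C - A) with hpdef
  set F : Pt := A + p • e with hF
  set h : ℝ := ‖C - F‖ with hhd
  have hCF : C - F ≠ 0 := by
    intro e0
    have hC : C = A + p • e := by rw [sub_eq_zero] at e0; rw [e0]
    have : Collinear ℝ {A, B, C} := by
      rw [collinear_iff_of_mem (p₀ := A) (by simp)]
      refine ⟨e, ?_⟩
      rintro x (rfl | rfl | rfl)
      · exact ⟨0, by simp⟩
      · exact ⟨c, by rw [← hBA]; simp⟩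
      · exact ⟨p, by rw [vadd_eq_add, add_comm]; exact hC⟩
    exact (affineIndependent_iff_not_collinear_set.1 hnd) this
  have hh0 : 0 < h := norm_pos_iff.2 hCF
  set n : Pt := h⁻¹ • (C - F) with hn
  have hnn : ‖n‖ = 1 := by rw [hn, norm_smul, norm_inv, Real.norm_of_nonneg hh0.le, ← hhd, inv_mul_cancel₀ hh0.ne']
  have hCn : C - F = h • n := by rw [hn, smul_smul, mul_inv_cancel₀ hh0.ne', one_smul]
  have hen0 : inner ℝ e n = 0 := by
    rw [hn, inner_smul_right, hF, ← sub_sub, inner_sub_right, inner_smul_right, hee, ← hpdef]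
    ring
  have hon : Orthonormal ℝ ![e, n] := by
    rw [orthonormal_iff_ite]
    intro i j
    fin_cases i <;> fin_cases j
    · simp [hen]
    · simpa using hen0
    · simpa [real_inner_comm] using hen0
    · simp [hnn]
  have hsp : ⊤ ≤ Submodule.span ℝ (Set.range ![e, n]) :=
    (hon.linearIndependent.span_eq_top_of_card_eq_finrank' (by simp)).ge
  let b : OrthonormalBasis (Fin 2) ℝ Pt := OrthonormalBasis.mk hon hsp
  have hb0 : b 0 = e := by simp [b]
  have hb1 : b 1 = n := by simp [b]
  have nb : ‖B - C‖ ^ 2 = c^2 - 2 * (c * p) + ‖C - A‖^2 := by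
    have : B - C = (B - A) - (C - A) := by abel
    rw [this, norm_sub_sq_real, hBA, inner_smul_left, norm_smul, hen, Real.norm_of_nonneg hc0.le]
    simp [hpdef]
  have d1 : ‖B - C‖ ≤ ‖C - A‖ := by rw [dist_eq_norm, dist_eq_norm, norm_sub_rev A C] at hSM; exact hSM
  have d2 : ‖C - A‖ ≤ c := by rw [dist_eq_norm, dist_eq_norm, norm_sub_rev A C, norm_sub_rev A B] at hML; exact hML
  have d3 : 0 < ‖C - A‖ := norm_pos_iff.2 (sub_ne_zero.2 hAC.symm)
  have d4 : 0 < ‖B - C‖ := norm_pos_iff.2 (sub_ne_zero.2 hBC)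
  have hp : 0 < p := by
    have : 0 < c * p := by nlinarith
    exact (pos_iff_pos_of_mul_pos this).1 hc0
  have hq : 0 < c - p := by
    have : 0 < c * (c - p) := by nlinarith
    exact (pos_iff_pos_of_mul_pos this).1 hc0
  refine ⟨p, c - p, h, F, b, hp, hq, hh0, ?_, ?_, ?_⟩
  · rw [Phi_apply, Lc_apply, hb0, hb1, hF]; simp
  · rw [Phi_apply, Lc_apply, hb0, hb1, hF, sub_smul, ← hBA]; simp
  · rw [Phi_apply, Lc_apply, hb0, hb1, ← hCn]; simp

lemma Phi_hull (p q h : ℝ) (hp : 0 < p) (hq : 0 < q) (hh : 0 < h) (F : Pt) (b : OrthonormalBasis (Fin 2) ℝ Pt) :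
    (Phi F b) ⁻¹' (convexHull ℝ {Phi F b (-p, 0), Phi F b (q, 0), Phi F b (0, h)}) = TTc p q h := by
  let g : (ℝ × ℝ) →ᵃ[ℝ] Pt := AffineMap.const ℝ (ℝ × ℝ) F + (Lc b : (ℝ × ℝ) →ₗ[ℝ] Pt).toAffineMap
  have hg : ∀ z, g z = Phi F b z := fun z => by simp [g, Phi_apply]
  have := g.image_convexHull {((-p, 0) : ℝ × ℝ), (q, 0), (0, h)}
  rw [TTc_hull p q h hp hq hh] at this
  simp only [Set.image_insert_eq, Set.image_singleton, hg] at this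
  rw [← this]
  exact Set.preimage_image_eq _ (Phi F b).injective

lemma Phi_seg (F : Pt) (b : OrthonormalBasis (Fin 2) ℝ Pt) (x y : ℝ × ℝ) (a c : ℝ) (hac : a + c = 1) :
    Phi F b (a • x + c • y) = a • Phi F b x + c • Phi F b y := by
  simp only [Phi_apply, map_add, map_smul, smul_add]
  have : F = a • F + c • F := by rw [← add_smul, hac, one_smul]
  nth_rw 1 [this]
  abel

theorem main_aux (p q h : ℝ) (hp : 0 < p) (hq : 0 < q) (hh : 0 < h) (F : Pt) (b : OrthonormalBasis (Fin 2) ℝ Pt)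
    (A B C : Pt) (hA : A = Phi F b (-p, 0)) (hB : B = Phi F b (q, 0)) (hC : C = Phi F b (0, h)) :
    lambda1 (interior (convexHull ℝ {A, B, C})) (segment ℝ A B) ≤
      lambda1 (interior (convexHull ℝ {A, B, C})) (segment ℝ A C ∪ segment ℝ B C) := by
  have hull : (Phi F b) ⁻¹' (convexHull ℝ {A, B, C}) = TTc p q h := by
    rw [hA, hB, hC]; exact Phi_hull p q h hp hq hh F b
  set Om := interior (convexHull ℝ {A, B, C}) with hOm
  have hpre : (Phi F b) ⁻¹' Om = TT p q h := by
    rw [hOm, (Phi F b).preimage_interior, hull, TTc_int p q h hp hq hh]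
  have hcpt : IsCompact (convexHull ℝ {A, B, C}) := (Set.toFinite {A, B, C}).isCompact_convexHull (𝕜 := ℝ)
  have hTTne : ((0, h / 2) : ℝ × ℝ) ∈ TT p q h := by
    refine ⟨by simpa using hh, ?_, ?_⟩ <;> · simp; field_simp; norm_num
  have hOne : Om.Nonempty := ⟨Phi F b (0, h/2), by rw [← Set.mem_preimage, hpre]; exact hTTne⟩
  have hclos : closure Om = convexHull ℝ {A, B, C} := by
    rw [hOm, (convex_convexHull ℝ _).closure_interior_eq_closure_of_nonempty_interior hOne]
    exact hcpt.isClosed.closure_eq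
  have int_eq : ∀ g : Pt → ℝ, ∫ x in Om, g x = ∫ z in TT p q h, g (Phi F b z) := by
    intro g; rw [Phi_int F b, hpre]
  have grad_eq : ∀ u : Pt → ℝ, ∫ x in Om, ((pd 0 u x)^2 + (pd 1 u x)^2) =
      ∫ z in TT p q h, ((fderiv ℝ (fun z => u (Phi F b z)) z (1, 0))^2 + (fderiv ℝ (fun z => u (Phi F b z)) z (0, 1))^2) := by
    intro u; rw [int_eq]; simp only [Phi_grad]
  have cdP : ContDiff ℝ 1 (Phi F b) := contDiff_const.add (Lc b).contDiff
  have cdS : ContDiff ℝ 1 (Phi F b).symm := by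
    have : ((Phi F b).symm : Pt → ℝ × ℝ) = fun x => (Lc b).symm (x - F) := funext (Phi_symm F b)
    rw [this]
    exact (Lc b).symm.contDiff.comp (contDiff_id.sub contDiff_const)
  set Λ := lambda1 Om (segment ℝ A B) with hΛ
  have nn : ∀ Sig, ∀ r ∈ RayleighSet Om Sig, 0 ≤ r := by
    rintro Sig r ⟨u, -, -, -, rfl⟩
    exact div_nonneg (integral_nonneg fun x => by positivity) (integral_nonneg fun x => by positivity)
  have hΛ0 : 0 ≤ Λ := Real.sInf_nonneg (nn _)
  have H : TestH p q h Λ := by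
    intro v hv hv0
    by_cases h0 : ∫ z in TT p q h, v z ^ 2 = 0
    · rw [h0, mul_zero]; exact integral_nonneg fun x => by positivity
    · have hpos : 0 < ∫ z in TT p q h, v z ^ 2 := lt_of_le_of_ne (integral_nonneg fun x => by positivity) (Ne.symm h0)
      rw [← le_div_iff₀ hpos]
      refine csInf_le ⟨0, nn _⟩ ⟨fun x => v ((Phi F b).symm x), ?_, ?_, ?_, ?_⟩
      · exact (hv.comp cdS).contDiffOn
      · rintro x ⟨a, c, ha, hc, hac, rfl⟩
        rw [hA, hB, ← Phi_seg F b _ _ _ _ hac]; beta_reduce; rw [Homeomorph.symm_apply_apply]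
        apply hv0
        simp
      · rw [int_eq]; simpa only [Homeomorph.symm_apply_apply] using h0
      · rw [grad_eq, int_eq]; simp only [Homeomorph.symm_apply_apply]
  apply le_csInf
  · let v : ℝ × ℝ → ℝ := fun z => (1 - (z.2 / h + z.1 / q)) * (1 - (z.2 / h - z.1 / p))
    have hv : ContDiff ℝ 1 v := by fun_prop
    refine ⟨_, fun x => v ((Phi F b).symm x), (hv.comp cdS).contDiffOn, ?_, ?_, rfl⟩
    · rintro x (⟨a, c, ha, hc, hac, rfl⟩ | ⟨a, c, ha, hc, hac, rfl⟩)
      · rw [hA, hC, ← Phi_seg F b _ _ _ _ hac]; beta_reduce; rw [Homeomorph.symm_apply_apply]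
        obtain rfl : a = 1 - c := by linarith
        simp only [v]
        apply mul_eq_zero_of_right
        simp; field_simp; ring
      · rw [hB, hC, ← Phi_seg F b _ _ _ _ hac]; beta_reduce; rw [Homeomorph.symm_apply_apply]
        obtain rfl : a = 1 - c := by linarith
        simp only [v]
        apply mul_eq_zero_of_left
        simp; field_simp; ring
    · rw [int_eq]; simp only [Homeomorph.symm_apply_apply]
      refine ne_of_gt ?_
      rw [setIntegral_pos_iff_support_of_nonneg_ae (Eventually.of_forall fun x => by positivity)]
      · refine lt_of_lt_of_le ((TT_open p q h).measure_pos volume ⟨_, hTTne⟩) (measure_mono ?_)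
        rintro z hz
        refine ⟨?_, hz⟩
        have h1 : 1 - (z.2 / h + z.1 / q) ≠ 0 := by linarith [hz.2.1]
        have h2 : 1 - (z.2 / h - z.1 / p) ≠ 0 := by linarith [hz.2.2]
        exact pow_ne_zero 2 (mul_ne_zero h1 h2)
      · exact ((hv.continuous.pow 2).continuousOn.integrableOn_compact (isCompact_Icc.prod isCompact_Icc)).mono_set (TT_sub p q h hp hq hh)
  · rintro r ⟨u, hu, hu0, hune, rfl⟩
    have hpos : 0 < ∫ x in Om, u x ^ 2 := lt_of_le_of_ne (integral_nonneg fun x => by positivity) (Ne.symm hune)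
    rw [le_div_iff₀ hpos, grad_eq, int_eq]
    have hw : ContDiffOn ℝ 1 (fun z => u (Phi F b z)) (TTc p q h) := by
      refine ContDiffOn.comp (t := closure Om) hu cdP.contDiffOn ?_
      intro z hz
      rw [hclos]
      rw [← hull] at hz; exact hz
    have hcT : IsCompact (TTc p q h) := by
      rw [← hull]; exact (Phi F b).isCompact_preimage.2 hcpt
    obtain ⟨K, hK0, hK⟩ := lip_of_cd (TTc p q h) (TTc_convex p q h) hcT
      (by rw [TTc_int p q h hp hq hh]; exact ⟨_, hTTne⟩) _ hw
    refine core p q h Λ hp hq hh hΛ0 H _ K hK0 hK ?_ ?_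
    · rintro z ⟨z1, z2, z3⟩ (e | e)
      · apply hu0
        right
        have hz1 : 0 ≤ z.1 := by
          by_contra hneg
          push Not at hneg
          have a1 : z.1 / q < 0 := div_neg_of_neg_of_pos hneg hq
          have a2 : z.1 / p < 0 := div_neg_of_neg_of_pos hneg hp
          linarith
        refine ⟨z.1 / q, z.2 / h, by positivity, by positivity, by linarith, ?_⟩
        rw [hB, hC, ← Phi_seg F b _ _ _ _ (by linarith)]
        congr 1
        ext <;> simp <;> field_simp
      · apply hu0
        left
        have hz1 : z.1 ≤ 0 := by
          by_contra hneg
          push Not at hneg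
          have a1 : 0 < z.1 / q := by positivity
          have a2 : 0 < z.1 / p := by positivity
          linarith
        have a2 : 0 ≤ (-z.1) / p := div_nonneg (by linarith) hp.le
        refine ⟨(-z.1) / p, z.2 / h, a2, by positivity, by rw [neg_div]; linarith, ?_⟩
        rw [hA, hC, ← Phi_seg F b _ _ _ _ (by rw [neg_div]; linarith)]
        congr 1
        ext <;> simp <;> field_simp
    · intro z hz
      refine (hw.contDiffAt ?_).hasStrictFDerivAt one_ne_zero
      rw [← mem_interior_iff_mem_nhds, TTc_int p q h hp hq hh]
      exact hz

/-- for any triangle, `λ₁^L ≤ λ₁^{M ∪ S}` where `L` is the longest side.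
Sides: `S = [B,C]`, `M = [A,C]`, `L = [A,B]`, ordered nondecreasingly by length. -/
theorem lambda1_longest_le (A B C : Pt)
    (hnd : AffineIndependent ℝ ![A, B, C])
    (hSM : dist B C ≤ dist A C) (hML : dist A C ≤ dist A B) :
    lambda1 (interior (convexHull ℝ {A, B, C})) (segment ℝ A B) ≤
      lambda1 (interior (convexHull ℝ {A, B, C})) (segment ℝ A C ∪ segment ℝ B C) := by
  obtain ⟨p, q, h, F, b, hp, hq, hh, hA, hB, hC⟩ := geom A B C hnd hSM hML
  exact main_aux p q h hp hq hh F b A B C hA hB hC
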